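/- arXiv:2502.11243 — 3 statements merged into one kernel-verified Lean document; each statement's English description precedes it below -/
import Mathlib

section
/- Let S be a solution concept that permits bracketing and satisfies expectation-monotonicity and anonymity. Then either S is a refinement of Nash (i.e., S(G) ⊆ Nash(G) for every game G), or there exists λ ≥ 0 such that S is a refinement of LQRE_λ (i.e., S(G) ⊆ LQRE_λ(G) for every game G). -/
open Filter Topology MeasureTheory

noncomputable section

namespace Paper

/-! ## Lotteries as finitely supported probability mass functions on ℝ -/

open Classical in
/-- The point mass at `a`. -/
def delta {α : Type*} (a : α) : α → ℝ := fun b => if b = a then 1 else 0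

/-- `f` is (the p.m.f. of) a finitely supported lottery. -/
def IsFinLottery (f : ℝ → ℝ) : Prop :=
  (∀ x, 0 ≤ f x) ∧ (Function.support f).Finite ∧ ∑ᶠ x, f x = 1

/-- The CDF of a mass function. -/
def cdfOf (f : ℝ → ℝ) (t : ℝ) : ℝ := ∑ᶠ x, if x ≤ t then f x else 0

/-- Convolution: the distribution of the sum of independent draws. -/
def conv (f g : ℝ → ℝ) : ℝ → ℝ := fun z => ∑ᶠ x, f x * g (z - x)

/-- Expectation of a finitely supported lottery. -/
def expOf (f : ℝ → ℝ) : ℝ := ∑ᶠ x, x * f x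

/-- Weak first-order stochastic dominance of `f` over `g`. -/
def FOSDgeF (f g : ℝ → ℝ) : Prop := ∀ t, cdfOf f t ≤ cdfOf g t

/-- Strict first-order stochastic dominance of `f` over `g`. -/
def FOSDgtF (f g : ℝ → ℝ) : Prop := FOSDgeF f g ∧ f ≠ g

/-- Finitely supported lotteries with rational-valued CDF (`Δ_ℚ`). -/
def IsDeltaQ (f : ℝ → ℝ) : Prop := IsFinLottery f ∧ ∀ t, ∃ q : ℚ, cdfOf f t = (q : ℝ)

/-- Monotone additive statistic on all finitely supported lotteries. -/
def MAS (Φ : (ℝ → ℝ) → ℝ) : Prop :=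
  (∀ c : ℝ, Φ (delta c) = c) ∧
  (∀ f g, IsFinLottery f → IsFinLottery g → Φ (conv f g) = Φ f + Φ g) ∧
  (∀ f g, IsFinLottery f → IsFinLottery g → FOSDgeF f g → Φ g ≤ Φ f)

/-- Monotone additive statistic on `Δ_ℚ`. -/
def MASQ (Φ : (ℝ → ℝ) → ℝ) : Prop :=
  (∀ c : ℝ, Φ (delta c) = c) ∧
  (∀ f g, IsDeltaQ f → IsDeltaQ g → Φ (conv f g) = Φ f + Φ g) ∧
  (∀ f g, IsDeltaQ f → IsDeltaQ g → FOSDgeF f g → Φ g ≤ Φ f)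

/-- The statistic `K_a` for `a` in the extended real line. -/
def Kstat (a : EReal) (f : ℝ → ℝ) : ℝ :=
  if a = ⊤ then sSup (Function.support f)
  else if a = ⊥ then sInf (Function.support f)
  else if a = 0 then expOf f
  else (a.toReal)⁻¹ * Real.log (∑ᶠ x, Real.exp (a.toReal * x) * f x)

/-- `K_a` for real `a`. -/
def Kreal (a : ℝ) : (ℝ → ℝ) → ℝ := Kstat (a : EReal)

/-- The statistic `Φ[X] = ∫ K_a[X] dμ(a)`. -/
def PhiInt (μ : Measure EReal) (f : ℝ → ℝ) : ℝ := ∫ a, Kstat a f ∂μ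

/-! ## Finite normal-form games -/

structure Game (N : ℕ) where
  A : Fin N → Type
  fintypeA : ∀ i, Fintype (A i)
  nonemptyA : ∀ i, Nonempty (A i)
  u : ((i : Fin N) → A i) → Fin N → ℝ

instance {N : ℕ} (G : Game N) (i : Fin N) : Fintype (G.A i) := G.fintypeA i
instance {N : ℕ} (G : Game N) (i : Fin N) : Nonempty (G.A i) := G.nonemptyA i

/-- A (mixed strategy) profile: a real-valued function on each action set. -/
abbrev Profile {N : ℕ} (G : Game N) := (i : Fin N) → G.A i → ℝ

/-- `p` is a mixed strategy profile. -/
def IsMixed {N : ℕ} (G : Game N) (p : Profile G) : Prop :=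
  ∀ i, (∀ ai, 0 ≤ p i ai) ∧ ∑ ai, p i ai = 1

/-- Probability of the full action profile `a` under independent mixing `p`. -/
def weight {N : ℕ} (G : Game N) (p : Profile G) (a : (i : Fin N) → G.A i) : ℝ :=
  ∏ j, p j (a j)

/-- The p.m.f. of player `i`'s payoff lottery `u_i(a_i, p_{-i})`. -/
def payMass {N : ℕ} (G : Game N) (p : Profile G) (i : Fin N) (ai : G.A i) : ℝ → ℝ :=
  fun t => ∑ a : (j : Fin N) → G.A j,
    if G.u a i = t then weight G (Function.update p i (delta ai)) a else 0

/-- Expected payoff `E[u_i(a_i, p_{-i})]`. -/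
def expPay {N : ℕ} (G : Game N) (p : Profile G) (i : Fin N) (ai : G.A i) : ℝ :=
  ∑ a : (j : Fin N) → G.A j, weight G (Function.update p i (delta ai)) a * G.u a i

/-- Expected value of `f` applied to player `i`'s payoff lottery. -/
def expPayOf {N : ℕ} (G : Game N) (p : Profile G) (i : Fin N) (ai : G.A i) (f : ℝ → ℝ) : ℝ :=
  ∑ a : (j : Fin N) → G.A j, weight G (Function.update p i (delta ai)) a * f (G.u a i)

/-- Minimum over `a_{-i}` of `u_i(a_i, a_{-i})`. -/
def minPay {N : ℕ} (G : Game N) (i : Fin N) (ai : G.A i) : ℝ :=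
  ⨅ a : (j : Fin N) → G.A j, G.u (Function.update a i ai) i

/-- Maximum over `a_{-i}` of `u_i(a_i, a_{-i})`. -/
def maxPay {N : ℕ} (G : Game N) (i : Fin N) (ai : G.A i) : ℝ :=
  ⨆ a : (j : Fin N) → G.A j, G.u (Function.update a i ai) i

/-- `a_i` is strictly dominated (by some `b_i`). -/
def StrictlyDominated {N : ℕ} (G : Game N) (i : Fin N) (ai : G.A i) : Prop :=
  ∃ bi : G.A i, ∀ a : (j : Fin N) → G.A j,
    G.u (Function.update a i ai) i < G.u (Function.update a i bi) i

/-! ## Solution concepts and axioms -/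

abbrev SolCon (N : ℕ) := (G : Game N) → Set (Profile G)

/-- A solution concept assigns to each game a nonempty set of mixed strategy profiles. -/
def IsSolutionConcept {N : ℕ} (S : SolCon N) : Prop :=
  ∀ G, (S G).Nonempty ∧ ∀ p ∈ S G, IsMixed G p

/-- The composite game `G ⊗ H`. -/
def Game.comp {N : ℕ} (G H : Game N) : Game N where
  A := fun i => G.A i × H.A i
  fintypeA := fun i => inferInstance
  nonemptyA := fun i => inferInstance
  u := fun c i => G.u (fun j => (c j).1) i + H.u (fun j => (c j).2) i

/-- The product profile `p × q`. -/
def prodProfile {N : ℕ} {G H : Game N} (p : Profile G) (q : Profile H) :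
    Profile (G.comp H) := fun i ab => p i ab.1 * q i ab.2

def Bracketing {N : ℕ} (S : SolCon N) : Prop :=
  ∀ (G H : Game N) (p : Profile G) (q : Profile H),
    p ∈ S G → q ∈ S H → prodProfile p q ∈ S (G.comp H)

/-- The permuted game `G_π`. -/
def Game.permute {N : ℕ} (G : Game N) (π : Equiv.Perm (Fin N)) : Game N where
  A := fun i => G.A (π i)
  fintypeA := fun i => G.fintypeA (π i)
  nonemptyA := fun i => G.nonemptyA (π i)
  u := fun b i =>
    G.u (fun j => cast (congrArg G.A (π.apply_symm_apply j)) (b (π.symm j))) (π i)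

def Anonymity {N : ℕ} (S : SolCon N) : Prop :=
  ∀ (π : Equiv.Perm (Fin N)) (G : Game N) (p : Profile G),
    p ∈ S G → (fun i => p (π i)) ∈ S (G.permute π)

def ExpectationMonotone {N : ℕ} (S : SolCon N) : Prop :=
  ∀ G, ∀ p ∈ S G, ∀ i, ∀ ai bi : G.A i,
    expPay G p i bi < expPay G p i ai → p i bi ≤ p i ai

def ExpectationNeutral {N : ℕ} (S : SolCon N) : Prop :=
  ∀ G, ∀ p ∈ S G, ∀ i, ∀ ai bi : G.A i,
    expPay G p i ai = expPay G p i bi → p i ai = p i bi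

def DistributionMonotone {N : ℕ} (S : SolCon N) : Prop :=
  ∀ G, ∀ p ∈ S G, ∀ i, ∀ ai bi : G.A i,
    FOSDgtF (payMass G p i ai) (payMass G p i bi) → p i bi ≤ p i ai

def Interiority {N : ℕ} (S : SolCon N) : Prop :=
  ∀ G, ∀ p ∈ S G, ∀ i, ∀ ai : G.A i, 0 < p i ai

/-- The game with payoffs rescaled by `α`. -/
def Game.scale {N : ℕ} (G : Game N) (α : ℝ) : Game N :=
  { G with u := fun a i => α * G.u a i }

def ScaleInvariant {N : ℕ} (S : SolCon N) : Prop :=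
  ∀ G : Game N, ∀ p ∈ S G,
    (∀ i, ∀ ai : G.A i, p i ai = ((Fintype.card (G.A i) : ℝ))⁻¹) →
    ∀ α ∈ Set.Ioo (0 : ℝ) 1, p ∈ S (G.scale α)

def StratInvariant {N : ℕ} (S : SolCon N) : Prop :=
  ∀ (G : Game N) (u' : ((i : Fin N) → G.A i) → Fin N → ℝ),
    (∀ i, ∃ w : ((j : Fin N) → G.A j) → ℝ,
      (∀ a, ∀ bi : G.A i, w (Function.update a i bi) = w a) ∧
      (∀ a, u' a i = G.u a i + w a)) →
    S G = S { G with u := u' }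

/-! ## Equilibrium notions -/

def IsNash {N : ℕ} (G : Game N) (p : Profile G) : Prop :=
  ∀ i, ∀ ai : G.A i, 0 < p i ai → ∀ bi : G.A i, expPay G p i bi ≤ expPay G p i ai

def IsLQRE {N : ℕ} (lam : ℝ) (G : Game N) (p : Profile G) : Prop :=
  ∀ i, ∀ ai : G.A i,
    p i ai = Real.exp (lam * expPay G p i ai) / ∑ bi, Real.exp (lam * expPay G p i bi)

def IsNashPhi {N : ℕ} (Φ : (ℝ → ℝ) → ℝ) (G : Game N) (p : Profile G) : Prop :=
  ∀ i, ∀ ai : G.A i, 0 < p i ai → ∀ bi : G.A i,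
    Φ (payMass G p i bi) ≤ Φ (payMass G p i ai)

def IsLQREPhi {N : ℕ} (Φ : (ℝ → ℝ) → ℝ) (lam : ℝ) (G : Game N) (p : Profile G) : Prop :=
  ∀ i, ∀ ai : G.A i,
    p i ai = Real.exp (lam * Φ (payMass G p i ai)) /
      ∑ bi, Real.exp (lam * Φ (payMass G p i bi))

def IsFOSDNash {N : ℕ} (G : Game N) (p : Profile G) : Prop :=
  ∀ i, ∀ ai : G.A i,
    (∃ bi : G.A i, FOSDgtF (payMass G p i bi) (payMass G p i ai)) → p i ai = 0

def IsFOSDQRE {N : ℕ} (G : Game N) (p : Profile G) : Prop :=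
  (∀ i, ∀ ai : G.A i, 0 < p i ai) ∧
  ∀ i, ∀ ai bi : G.A i,
    FOSDgeF (payMass G p i ai) (payMass G p i bi) → p i bi ≤ p i ai

def IsMinMaxMean {N : ℕ} (l1 l2 l3 : ℝ) (G : Game N) (p : Profile G) : Prop :=
  ∀ i, ∀ ai : G.A i,
    p i ai = Real.exp (l1 * minPay G i ai + l2 * expPay G p i ai + l3 * maxPay G i ai) /
      ∑ bi, Real.exp (l1 * minPay G i bi + l2 * expPay G p i bi + l3 * maxPay G i bi)

def CompatibleEU {N : ℕ} (S : SolCon N) : Prop :=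
  ∃ f : ℝ → ℝ, StrictMono f ∧ Continuous f ∧
    ∀ G, ∀ p ∈ S G, ∀ i, ∀ ai bi : G.A i,
      expPayOf G p i bi f < expPayOf G p i ai f → p i bi ≤ p i ai

/-! ## Lotteries as compactly supported probability measures on ℝ -/

/-- Convolution of measures: distribution of the sum of independent draws. -/
def mconv (μ ν : Measure ℝ) : Measure ℝ := (μ.prod ν).map (fun z : ℝ × ℝ => z.1 + z.2)

/-- `npow μ m` is the `m`-fold convolution `μ^m`. -/
def npow (μ : Measure ℝ) : ℕ → Measure ℝ
  | 0 => Measure.dirac 0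
  | n + 1 => mconv (npow μ n) μ

/-- The distribution of `β` times a draw from `μ`. -/
def mscale (β : ℝ) (μ : Measure ℝ) : Measure ℝ := μ.map (fun x => β * x)

/-- `μ` is compactly supported. -/
def CompSupp (μ : Measure ℝ) : Prop := ∃ a b : ℝ, μ (Set.Icc a b)ᶜ = 0

/-- The minimum of the support of `μ`. -/
def minSupp (μ : Measure ℝ) : ℝ := sSup {x : ℝ | μ (Set.Iio x) = 0}

/-- The maximum of the support of `μ`. -/
def maxSupp (μ : Measure ℝ) : ℝ := sInf {x : ℝ | μ (Set.Ioi x) = 0}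

/-- Weak first-order stochastic dominance of `μ` over `ν`. -/
def FOSDgeM (μ ν : Measure ℝ) : Prop := ∀ t, μ (Set.Iic t) ≤ ν (Set.Iic t)

/-- Strict first-order stochastic dominance of `μ` over `ν`. -/
def FOSDgtM (μ ν : Measure ℝ) : Prop := FOSDgeM μ ν ∧ μ ≠ ν

/-- Monotone additive statistic on compactly supported lotteries (as measures). -/
def MASm (Φ : Measure ℝ → ℝ) : Prop :=
  (∀ c : ℝ, Φ (Measure.dirac c) = c) ∧
  (∀ μ ν : Measure ℝ, IsProbabilityMeasure μ → IsProbabilityMeasure ν →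
    CompSupp μ → CompSupp ν → Φ (mconv μ ν) = Φ μ + Φ ν) ∧
  (∀ μ ν : Measure ℝ, IsProbabilityMeasure μ → IsProbabilityMeasure ν →
    CompSupp μ → CompSupp ν → FOSDgeM μ ν → Φ ν ≤ Φ μ)

/-! ## Two-player games, unbundled -/

/-- `p` is a probability distribution on the finite type `α`. -/
def IsDist {α : Type*} [Fintype α] (p : α → ℝ) : Prop :=
  (∀ a, 0 ≤ p a) ∧ ∑ a, p a = 1

/-- Payoff lottery of player 1 playing `a` against the mixed strategy `q`. -/
def mass1 {α β : Type*} [Fintype β] (u : α → β → ℝ) (q : β → ℝ) (a : α) : ℝ → ℝ :=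
  fun t => ∑ b, if u a b = t then q b else 0

/-- Payoff lottery of player 2 playing `b` against the mixed strategy `p`. -/
def mass2 {α β : Type*} [Fintype α] (u : α → β → ℝ) (p : α → ℝ) (b : β) : ℝ → ℝ :=
  fun t => ∑ a, if u a b = t then p a else 0

/-- The distribution of a random variable on the uniform space `{1,…,m}`. -/
def distOf {m : ℕ} (X : Fin m → ℝ) : ℝ → ℝ :=
  fun t => (∑ ω : Fin m, if X ω = t then (1 : ℝ) else 0) / m


lemma delta_prod {α β : Type*} (a : α) (b : β) (c : α × β) :
    delta (a, b) c = delta a c.1 * delta b c.2 := by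
  obtain ⟨x, y⟩ := c
  by_cases hx : x = a <;> by_cases hy : y = b <;> simp [delta, hx, hy]

lemma sum_delta {α : Type*} [Fintype α] (a : α) : ∑ b, delta a b = 1 := by
  classical
  simp [delta]

lemma sum_weight_update_delta {N : ℕ} (G : Game N) (p : Profile G) (hp : IsMixed G p)
    (i : Fin N) (ai : G.A i) :
    ∑ a : (j : Fin N) → G.A j, weight G (Function.update p i (delta ai)) a = 1 := by
  classical
  simp only [weight]
  rw [← Fintype.prod_sum]
  refine Finset.prod_eq_one fun j _ => ?_
  by_cases hj : j = i
  · subst hj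
    simp [sum_delta]
  · simp [Function.update_of_ne hj, (hp j).2]

lemma weight_prodProfile_update {N : ℕ} (G H : Game N) (p : Profile G) (q : Profile H)
    (i : Fin N) (ai : G.A i) (bi : H.A i) (c : (j : Fin N) → (G.comp H).A j) :
    weight (G.comp H)
        (Function.update (prodProfile p q) i (delta ((ai, bi) : G.A i × H.A i))) c =
      weight G (Function.update p i (delta ai)) (fun j => (c j).1) *
        weight H (Function.update q i (delta bi)) (fun j => (c j).2) := by
  simp only [weight]
  rw [← Finset.prod_mul_distrib]
  refine Finset.prod_congr rfl fun j _ => ?_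
  by_cases hj : j = i
  · subst hj
    simp only [Function.update_self]
    exact delta_prod ai bi (c j)
  · simp only [Function.update_of_ne hj]
    rfl

/-- Splitting an action profile of a composite game into its two components. -/
def Game.compEquiv {N : ℕ} (G H : Game N) :
    ((j : Fin N) → (G.comp H).A j) ≃ ((j : Fin N) → G.A j) × ((j : Fin N) → H.A j) where
  toFun c := (fun j => (c j).1, fun j => (c j).2)
  invFun ab := fun j => (ab.1 j, ab.2 j)
  left_inv _ := rfl
  right_inv _ := rfl

lemma expPay_comp {N : ℕ} (G H : Game N) (p : Profile G) (q : Profile H)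
    (hp : IsMixed G p) (hq : IsMixed H q) (i : Fin N) (ai : G.A i) (bi : H.A i) :
    expPay (G.comp H) (prodProfile p q) i ((ai, bi) : G.A i × H.A i) =
      expPay G p i ai + expPay H q i bi := by
  have h1 := sum_weight_update_delta G p hp i ai
  have h2 := sum_weight_update_delta H q hq i bi
  unfold expPay
  simp_rw [weight_prodProfile_update]
  refine (Fintype.sum_equiv (G.compEquiv H) _
    (fun ab : ((j : Fin N) → G.A j) × ((j : Fin N) → H.A j) =>
      weight G (Function.update p i (delta ai)) ab.1 *
        weight H (Function.update q i (delta bi)) ab.2 * (G.u ab.1 i + H.u ab.2 i))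
    (fun c => rfl)).trans ?_
  rw [Fintype.sum_prod_type]
  calc _ = ∑ a, ∑ b,
        ((weight G (Function.update p i (delta ai)) a * G.u a i) *
            weight H (Function.update q i (delta bi)) b +
          weight G (Function.update p i (delta ai)) a *
            (weight H (Function.update q i (delta bi)) b * H.u b i)) := by
        refine Finset.sum_congr rfl fun a _ => Finset.sum_congr rfl fun b _ => ?_
        ring
    _ = _ := by
        simp_rw [Finset.sum_add_distrib, ← Finset.mul_sum, ← Finset.sum_mul]
        rw [h1, h2, mul_one, one_mul]

/-- Relabelling the players of an action profile. -/
def Game.permuteEquiv {N : ℕ} (G : Game N) (π : Equiv.Perm (Fin N)) :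
    ((j : Fin N) → (G.permute π).A j) ≃ ((j : Fin N) → G.A j) where
  toFun b := fun j => cast (congrArg G.A (π.apply_symm_apply j)) (b (π.symm j))
  invFun a := fun j => a (π j)
  left_inv b := by
    funext j
    exact eq_of_heq ((cast_heq _ _).trans (congr_arg_heq b (π.symm_apply_apply j)))
  right_inv a := by
    funext j
    exact eq_of_heq ((cast_heq _ _).trans (congr_arg_heq a (π.apply_symm_apply j)))

lemma expPay_permute {N : ℕ} (G : Game N) (p : Profile G) (π : Equiv.Perm (Fin N))
    (i : Fin N) (ai : G.A (π i)) :
    expPay (G.permute π) (fun j => p (π j)) i ai = expPay G p (π i) ai := by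
  unfold expPay
  refine (Fintype.sum_equiv (G.permuteEquiv π).symm _ _ fun a => ?_).symm
  have hu : (G.permute π).u ((G.permuteEquiv π).symm a) i = G.u a (π i) :=
    congrArg (fun b => G.u b (π i)) ((G.permuteEquiv π).apply_symm_apply a)
  rw [hu]
  congr 1
  unfold weight
  rw [← Equiv.prod_comp π]
  refine Finset.prod_congr rfl fun j _ => ?_
  by_cases hj : j = i
  · subst hj
    rw [Function.update_self]
    exact (congrFun (Function.update_self j (delta ai) fun k => p (π k)) (a (π j))).symm
  · rw [Function.update_of_ne (fun h => hj (π.injective h))]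
    exact (congrFun (Function.update_of_ne hj (delta ai) fun k => p (π k)) (a (π j))).symm

/-- If `L` is nonnegative on the right half plane of an additive subgroup of `ℝ × ℝ`, then the
subgroup lies on a line through the origin. -/
lemma AddSubgroup.snd_eq_slope_mul_fst (T : AddSubgroup (ℝ × ℝ))
    (hT : ∀ v ∈ T, 0 < v.1 → 0 ≤ v.2) {d l : ℝ} (hd : 0 < d) (hdl : (d, l) ∈ T)
    {v : ℝ × ℝ} (hv : v ∈ T) : v.2 = l / d * v.1 := by
  have hl : 0 ≤ l := hT _ hdl hd
  have key : ∀ w ∈ T, l / d * w.1 ≤ w.2 := by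
    rintro ⟨e, k⟩ hw
    by_contra! hlt
    simp only at hlt
    obtain ⟨n, hn⟩ := exists_nat_gt (l / (l / d * e - k))
    have hgap : 0 < l / d * e - k := by linarith
    rw [div_lt_iff₀ hgap] at hn
    have hmem := T.add_mem (T.zsmul_mem hdl (⌊-(n * e) / d⌋ + 1)) (T.nsmul_mem hw n)
    have hlow : -(n * e) < ((⌊-(n * e) / d⌋ : ℝ) + 1) * d :=
      (div_lt_iff₀ hd).1 (Int.lt_floor_add_one _)
    have hupp : (⌊-(n * e) / d⌋ : ℝ) * d ≤ -(n * e) :=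
      (le_div_iff₀ hd).1 (Int.floor_le _)
    have h0 := hT _ hmem (by simp; linarith)
    simp at h0
    have hmul := mul_le_mul_of_nonneg_left hupp (div_nonneg hl hd.le)
    have hcancel : l / d * d = l := div_mul_cancel₀ l hd.ne'
    have : l / d * ((⌊-(n * e) / d⌋ : ℝ) * d) = (⌊-(n * e) / d⌋ : ℝ) * l := by
      rw [mul_left_comm, hcancel]
    nlinarith
  have h1 := key v hv
  have h2 := key (-v) (T.neg_mem hv)
  simp at h2
  linarith

lemma IsMixed.exists_pos {N : ℕ} {G : Game N} {p : Profile G} (hp : IsMixed G p) (i : Fin N) :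
    ∃ ai : G.A i, 0 < p i ai := by
  by_contra! h
  have := Finset.sum_nonpos (s := Finset.univ) (fun a _ => h a)
  rw [(hp i).2] at this
  linarith

/-- The pairs (expected payoff difference, log-probability ratio) realised by two actions of
player `i`, both played with positive probability, in some solution of some game. -/
def tradeoffs {N : ℕ} (S : SolCon N) (hS : IsSolutionConcept S) (hBr : Bracketing S)
    (i : Fin N) : AddSubgroup (ℝ × ℝ) where
  carrier := {v | ∃ G, ∃ p ∈ S G, ∃ a b : G.A i, 0 < p i a ∧ 0 < p i b ∧
    v = (expPay G p i a - expPay G p i b, Real.log (p i a) - Real.log (p i b))}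
  zero_mem' := by
    let G : Game N := ⟨fun _ => Unit, fun _ => inferInstance, fun _ => inferInstance, fun _ _ => 0⟩
    obtain ⟨p, hp⟩ := (hS G).1
    obtain ⟨a, ha⟩ := ((hS G).2 p hp).exists_pos i
    exact ⟨G, p, hp, a, a, ha, ha, by simp only [sub_self]; rfl⟩
  add_mem' := by
    rintro _ _ ⟨G, p, hp, a, b, ha, hb, rfl⟩ ⟨H, q, hq, c, d, hc, hd, rfl⟩
    refine ⟨G.comp H, prodProfile p q, hBr G H p q hp hq, (a, c), (b, d), mul_pos ha hc,
      mul_pos hb hd, ?_⟩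
    rw [expPay_comp G H p q ((hS G).2 p hp) ((hS H).2 q hq),
      expPay_comp G H p q ((hS G).2 p hp) ((hS H).2 q hq)]
    simp only [prodProfile, Prod.mk_add_mk]
    rw [Real.log_mul ha.ne' hc.ne', Real.log_mul hb.ne' hd.ne']
    ext <;> simp only <;> ring
  neg_mem' := by
    rintro _ ⟨G, p, hp, a, b, ha, hb, rfl⟩
    exact ⟨G, p, hp, b, a, hb, ha, by simp⟩

lemma mem_tradeoffs {N : ℕ} {S : SolCon N} {hS : IsSolutionConcept S} {hBr : Bracketing S}
    {i : Fin N} {v : ℝ × ℝ} :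
    v ∈ tradeoffs S hS hBr i ↔ ∃ G, ∃ p ∈ S G, ∃ a b : G.A i, 0 < p i a ∧ 0 < p i b ∧
      v = (expPay G p i a - expPay G p i b, Real.log (p i a) - Real.log (p i b)) :=
  Iff.rfl

/-- bracketing + expectation-monotonicity + anonymity imply that `S`
refines Nash or refines `LQRE_λ` for some `λ ≥ 0`. -/
theorem stmt0 {N : ℕ} (hN : 2 ≤ N) (S : SolCon N) (hS : IsSolutionConcept S)
    (hBr : Bracketing S) (hEM : ExpectationMonotone S) (hAn : Anonymity S) :
    (∀ G, ∀ p ∈ S G, IsNash G p) ∨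
      ∃ lam : ℝ, 0 ≤ lam ∧ ∀ G, ∀ p ∈ S G, IsLQRE lam G p := by
  by_cases hNash : ∀ G, ∀ p ∈ S G, IsNash G p
  · exact Or.inl hNash
  right
  simp only [IsNash] at hNash
  push Not at hNash
  obtain ⟨G, p, hp, i, a, ha, b, hab⟩ := hNash
  have hb : 0 < p i b := ha.trans_le (hEM G p hp i b a hab)
  set T := tradeoffs S hS hBr i
  have hT : ∀ v ∈ T, 0 < v.1 → 0 ≤ v.2 := by
    rintro _ ⟨H, q, hq, c, d, hc, hd, rfl⟩ hpos
    exact sub_nonneg.2 (Real.log_le_log hd (hEM H q hq i c d (sub_pos.1 hpos)))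
  set d := expPay G p i b - expPay G p i a
  set l := Real.log (p i b) - Real.log (p i a)
  have hd : 0 < d := sub_pos.2 hab
  have hdl : (d, l) ∈ T := ⟨G, p, hp, b, a, hb, ha, rfl⟩
  have hpos : ∀ H, ∀ q ∈ S H, ∀ c : H.A i, 0 < q i c := by
    intro H q hq c
    obtain ⟨c', hc'⟩ := ((hS H).2 q hq).exists_pos i
    obtain ⟨m, hm⟩ := exists_nat_gt ((expPay H q i c' - expPay H q i c) / d)
    rw [div_lt_iff₀ hd] at hm
    obtain ⟨K, r, hr, x, y, hx, hy, hxy⟩ := mem_tradeoffs.1 (T.nsmul_mem hdl m)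
    have hfst : m * d = expPay K r i x - expPay K r i y := by
      simpa using congrArg Prod.fst hxy
    have hmon := hEM _ _ (hBr K H r q hr hq) i (x, c) (y, c') (by
      rw [expPay_comp K H r q ((hS K).2 r hr) ((hS H).2 q hq),
        expPay_comp K H r q ((hS K).2 r hr) ((hS H).2 q hq)]
      linarith)
    exact pos_of_mul_pos_right ((mul_pos hy hc').trans_le hmon) hx.le
  have hratio : ∀ H, ∀ q ∈ S H, ∀ x y : H.A i,
      q i x = q i y * Real.exp (l / d * (expPay H q i x - expPay H q i y)) := by
    intro H q hq x y
    have hx := hpos H q hq x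
    have hy := hpos H q hq y
    have := AddSubgroup.snd_eq_slope_mul_fst T hT hd hdl
      (v := (expPay H q i x - expPay H q i y, Real.log (q i x) - Real.log (q i y)))
      ⟨H, q, hq, x, y, hx, hy, rfl⟩
    simp only at this
    rw [← this, Real.exp_sub, Real.exp_log hx, Real.exp_log hy]
    field_simp
  refine ⟨l / d, div_nonneg (hT _ hdl hd) hd.le, fun H q hq j x => ?_⟩
  have hratio' : ∀ y z : H.A j,
      q j y = q j z * Real.exp (l / d * (expPay H q j y - expPay H q j z)) := by
    obtain ⟨π, rfl⟩ : ∃ π : Equiv.Perm (Fin N), π i = j :=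
      ⟨Equiv.swap i j, Equiv.swap_apply_left i j⟩
    intro y z
    have := hratio _ _ (hAn π H q hq) y z
    rwa [expPay_permute, expPay_permute] at this
  have hsum := ((hS H).2 q hq j).2
  have hpos' : 0 < ∑ y, Real.exp (l / d * expPay H q j y) :=
    Finset.sum_pos (fun _ _ => Real.exp_pos _) Finset.univ_nonempty
  rw [eq_div_iff hpos'.ne', Finset.mul_sum]
  calc ∑ y, q j x * Real.exp (l / d * expPay H q j y)
      = ∑ y, q j y * Real.exp (l / d * expPay H q j x) := by
        refine Finset.sum_congr rfl fun y _ => ?_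
        rw [hratio' y x, mul_assoc, ← Real.exp_add]
        ring_nf
    _ = Real.exp (l / d * expPay H q j x) := by rw [← Finset.sum_mul, hsum, one_mul]

end Paper
end
end

section
/- Let μ be a Borel probability measure on the extended real line ℝ̄ = ℝ∪{−∞,+∞} and define Φ[X] = ∫_{ℝ̄} K_a[X] dμ(a) for every finitely supported real-valued lottery X. Then for every finite normal-form game G=(A,u) and every λ ≥ 0, there exists a mixed strategy profile p that is an LQRE_{λΦ} equilibrium of G, i.e., p_i(a_i) = exp(λΦ[u_i(a_i,p_{-i})]) / Σ_{b_i∈A_i} exp(λΦ[u_i(b_i,p_{-i})]) for every player i and every a_i∈A_i. -/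
open Filter Topology MeasureTheory

noncomputable section

namespace Paper

/-! ## Brouwer's fixed point theorem via dominant sets

A room is a dominant set with as many elements as there are orders, a door is a dominant set with
one element less. -/

/-- Each vertex `v` is, for some `i`, below all of `S` in the order given by `h i`. -/
def Dominant {V I L : Type*} [LinearOrder L] (h : I → V → L) (S : Finset V) : Prop :=
  ∀ v, ∃ i, ∀ s ∈ S, h i v ≤ h i s

lemma Dominant.mono {V I L : Type*} [LinearOrder L] {h : I → V → L} {S D : Finset V}
    (hS : Dominant h S) (hD : D ⊆ S) : Dominant h D := fun v =>
  (hS v).imp fun _ hi s hs => hi s (hD hs)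

/-- `x` is the `h j`-largest vertex lying above `m i` in the order `h i` for all `i ≠ j`. -/
def IsPivot {V I L : Type*} [LinearOrder L] (h : I → V → L) (m : I → V) (j : I) (x : V) : Prop :=
  (∀ i, i ≠ j → h i (m i) < h i x) ∧ ∀ v, (∀ i, i ≠ j → h i (m i) < h i v) → h j v ≤ h j x

lemma IsPivot.unique {V I L : Type*} [LinearOrder L] {h : I → V → L}
    (hinj : ∀ i, Function.Injective (h i)) {m : I → V} {j : I} {x y : V}
    (hx : IsPivot h m j x) (hy : IsPivot h m j y) : x = y :=
  hinj j (le_antisymm (hy.2 x hx.1) (hx.2 y hy.1))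

lemma exists_isPivot {V I L : Type*} [Fintype V] [LinearOrder L] (h : I → V → L)
    (m : I → V) (j : I) (hne : ∃ v, ∀ i, i ≠ j → h i (m i) < h i v) :
    ∃ x, IsPivot h m j x := by
  classical
  obtain ⟨v, hv⟩ := hne
  obtain ⟨x, hx, hmax⟩ := Finset.exists_max_image
    (Finset.univ.filter fun v => ∀ i, i ≠ j → h i (m i) < h i v) (h j) ⟨v, by simpa using hv⟩
  refine ⟨x, by simpa using hx, fun w hw => hmax w (by simpa using hw)⟩

/-- The two orders whose minima over a door coincide, and the rooms adjacent to that door. -/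
lemma exists_pair_of_door {V I L : Type*} [DecidableEq V] [Fintype I]
    [LinearOrder L] {h : I → V → L} (hinj : ∀ i, Function.Injective (h i)) {D : Finset V}
    (hD : Dominant h D) (hcard : D.card + 1 = Fintype.card I) {m : I → V}
    (hmD : ∀ i, m i ∈ D) (hm : ∀ i, ∀ s ∈ D, h i (m i) ≤ h i s) :
    ∃ a b, a ≠ b ∧ m a = m b ∧
      ∀ x, (x ∉ D ∧ Dominant h (insert x D)) ↔ (IsPivot h m a x ∨ IsPivot h m b x) := by
  classical
  have hsurj : ∀ s ∈ D, ∃ i, m i = s := fun s hs => by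
    obtain ⟨i, hi⟩ := hD s
    exact ⟨i, hinj i (le_antisymm (hm i s hs) (hi _ (hmD i)))⟩
  obtain ⟨a, -, b, -, hab, hmab⟩ := Finset.exists_ne_map_eq_of_card_lt_of_maps_to
    (s := Finset.univ) (t := D) (f := m) (by rw [Finset.card_univ]; omega) (fun i _ => hmD i)
  have hback : ∀ j k x, j ≠ k → m j = m k → IsPivot h m j x →
      x ∉ D ∧ Dominant h (insert x D) := by
    intro j k x hjk hmjk hx
    refine ⟨fun hxD => ?_, fun v => ?_⟩
    · obtain ⟨i, rfl⟩ := hsurj x hxD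
      by_cases hij : i = j
      · subst hij
        have := hx.1 k hjk.symm
        rw [hmjk] at this
        exact lt_irrefl _ this
      · exact lt_irrefl _ (hx.1 i hij)
    · by_cases hv : ∀ i, i ≠ j → h i (m i) < h i v
      · obtain ⟨i, hi⟩ := hD v
        have hij : i = j := by
          by_contra hij
          exact absurd (hi _ (hmD i)) (not_le.2 (hv i hij))
        subst hij
        refine ⟨i, fun s hs => ?_⟩
        rcases Finset.mem_insert.1 hs with rfl | hs
        · exact hx.2 v hv
        · exact hi s hs
      · push Not at hv
        obtain ⟨i, hij, hi⟩ := hv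
        refine ⟨i, fun s hs => ?_⟩
        rcases Finset.mem_insert.1 hs with rfl | hs
        · exact hi.trans (hx.1 i hij).le
        · exact hi.trans (hm i s hs)
  refine ⟨a, b, hab, hmab, fun x => ⟨fun ⟨hxD, hx⟩ => ?_, fun hx => ?_⟩⟩
  · obtain ⟨j, hj⟩ := hx x
    have hcov : ∀ s ∈ D, ∃ i, i ≠ j ∧ m i = s ∧ h i s ≤ h i x := fun s hs => by
      obtain ⟨i, hi⟩ := hx s
      refine ⟨i, ?_, ?_, hi x (Finset.mem_insert_self _ _)⟩
      · rintro rfl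
        have := hinj i (le_antisymm (hi x (Finset.mem_insert_self _ _))
          (hj s (Finset.mem_insert_of_mem hs)))
        exact hxD (this ▸ hs)
      · exact hinj i (le_antisymm (hm i s hs) (hi _ (Finset.mem_insert_of_mem (hmD i))))
    have hinjOn : Set.InjOn m (Finset.univ.erase j : Finset I) := by
      refine Finset.injOn_of_surjOn_of_card_le (t := D) m (fun i _ => hmD i) (fun s hs => ?_) ?_
      · obtain ⟨i, hij, his, -⟩ := hcov s hs
        exact ⟨i, by simpa using hij, his⟩
      · rw [Finset.card_erase_of_mem (Finset.mem_univ _), Finset.card_univ]; omega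
    have hpiv : IsPivot h m j x := by
      refine ⟨fun i hij => ?_, fun v hv => ?_⟩
      · obtain ⟨k, hkj, hk, hle⟩ := hcov (m i) (hmD i)
        have : k = i := hinjOn (by simpa using hkj) (by simpa using hij) hk
        subst this
        refine lt_of_le_of_ne hle fun heq => hxD ?_
        rw [← hinj k heq]; exact hmD k
      · obtain ⟨i, hi⟩ := hx v
        have hij : i = j := by
          by_contra hij
          exact absurd (hi _ (Finset.mem_insert_of_mem (hmD i))) (not_le.2 (hv i hij))
        subst hij
        exact hi x (Finset.mem_insert_self _ _)
    by_cases hja : j = a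
    · exact Or.inl (hja ▸ hpiv)
    by_cases hjb : j = b
    · exact Or.inr (hjb ▸ hpiv)
    exact absurd (hinjOn (by simpa using Ne.symm hja) (by simpa using Ne.symm hjb) hmab) hab
  · rcases hx with hx | hx
    · exact hback a b x hab hmab hx
    · exact hback b a x hab.symm hmab.symm hx

open Classical in
/-- The rooms containing a door `D` are the sets `insert x D` for the vertices `x` in `P`. -/
lemma card_rooms_eq {V L I : Type*} [Fintype V] [Fintype I] [LinearOrder L]
    {h : I → V → L} {D P : Finset V} (hcard : D.card + 1 = Fintype.card I)
    (hP : ∀ x, (x ∉ D ∧ Dominant h (insert x D)) ↔ x ∈ P) :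
    (Finset.univ.filter fun S : Finset V =>
      (Dominant h S ∧ S.card = Fintype.card I) ∧ D ⊆ S).card = P.card := by
  symm
  refine Finset.card_bij (fun x _ => insert x D) (fun x hx => ?_) (fun x hx y hy hxy => ?_)
    (fun S hS => ?_)
  · obtain ⟨hxD, hdom⟩ := (hP x).2 hx
    simp [hdom, Finset.card_insert_of_notMem hxD, hcard]
  · have hx' := ((hP x).2 hx).1
    have : x ∈ insert y D := hxy ▸ Finset.mem_insert_self x D
    exact (Finset.mem_insert.1 this).resolve_right hx'
  · simp only [Finset.mem_filter, Finset.mem_univ, true_and] at hS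
    obtain ⟨⟨hdom, hSc⟩, hDS⟩ := hS
    obtain ⟨x, hxD, rfl⟩ := (Finset.covBy_iff_exists_insert.1
      ((Finset.covBy_iff_card_sdiff_eq_one).2 ⟨hDS, by
        rw [Finset.card_sdiff_of_subset hDS]; omega⟩))
    exact ⟨x, (hP x).1 ⟨hxD, hdom⟩, rfl⟩

open Classical in
/-- A room that is not fully coloured has an even number of doors coloured by all colours
except `i₀`. -/
lemma even_card_doors {V I : Type*} [Fintype V] [Fintype I] (c : V → I) (i₀ : I)
    {S : Finset V} (hS : S.card = Fintype.card I) (hc : ¬ Set.InjOn c S)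
    (Q : Finset V → Prop) (hQ : ∀ D ⊆ S, Q D) :
    Even (Finset.univ.filter fun D : Finset V =>
      (Q D ∧ D.card + 1 = Fintype.card I ∧ D.image c = Finset.univ.erase i₀) ∧ D ⊆ S).card := by
  set F := Finset.univ.filter fun D : Finset V =>
      (Q D ∧ D.card + 1 = Fintype.card I ∧ D.image c = Finset.univ.erase i₀) ∧ D ⊆ S with hF
  rcases F.eq_empty_or_nonempty with hE | ⟨D, hD⟩
  · simp [hE]
  have hinj : ∀ D ∈ F, Set.InjOn c D := fun D hD => by
    simp only [hF, Finset.mem_filter, Finset.mem_univ, true_and] at hD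
    rw [← Finset.card_image_iff, hD.1.2.2, Finset.card_erase_of_mem (Finset.mem_univ _),
      Finset.card_univ]
    omega
  have hform : ∀ D ∈ F, ∃ x ∈ S, D = S.erase x := fun D hD => by
    simp only [hF, Finset.mem_filter, Finset.mem_univ, true_and] at hD
    obtain ⟨x, hxD, rfl⟩ := (Finset.covBy_iff_exists_insert.1
      ((Finset.covBy_iff_card_sdiff_eq_one).2 ⟨hD.2, by
        rw [Finset.card_sdiff_of_subset hD.2]; omega⟩))
    exact ⟨x, by simp, (Finset.erase_insert hxD).symm⟩
  obtain ⟨x, hxS, rfl⟩ := hform D hD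
  have hxinj := hinj _ hD
  have himg := hD
  simp only [hF, Finset.mem_filter, Finset.mem_univ, true_and] at himg
  replace himg := himg.1.2.2
  have hy : ∃ y ∈ S, y ≠ x ∧ c y = c x := by
    by_contra! hcon
    refine hc fun u hu v hv huv => ?_
    by_cases hux : u = x <;> by_cases hvx : v = x
    · rw [hux, hvx]
    · exact absurd (hux ▸ huv.symm) (hcon v hv hvx)
    · exact absurd (hvx ▸ huv) (hcon u hu hux)
    · exact hxinj (by simp [hux]; simpa using hu) (by simp [hvx]; simpa using hv) huv
  obtain ⟨y, hyS, hyx, hcy⟩ := hy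
  have hmem : S.erase y ∈ F := by
    simp only [hF, Finset.mem_filter, Finset.mem_univ, true_and]
    refine ⟨⟨hQ _ (Finset.erase_subset _ _), ?_, ?_⟩, Finset.erase_subset _ _⟩
    · rw [Finset.card_erase_add_one hyS, hS]
    · rw [← himg]
      ext k
      simp only [Finset.mem_image, Finset.mem_erase]
      constructor
      · rintro ⟨z, ⟨hzy, hzS⟩, rfl⟩
        by_cases hzx : z = x
        · exact ⟨y, ⟨hyx, hyS⟩, by rw [hcy, hzx]⟩
        · exact ⟨z, ⟨hzx, hzS⟩, rfl⟩
      · rintro ⟨z, ⟨hzx, hzS⟩, rfl⟩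
        by_cases hzy : z = y
        · exact ⟨x, ⟨hyx.symm, hxS⟩, by rw [← hcy, hzy]⟩
        · exact ⟨z, ⟨hzy, hzS⟩, rfl⟩
  have hFeq : F = {S.erase x, S.erase y} := by
    ext D
    simp only [Finset.mem_insert, Finset.mem_singleton]
    constructor
    · intro hDF
      obtain ⟨z, hzS, rfl⟩ := hform D hDF
      by_contra! hne
      have hzx : x ≠ z := fun h => hne.1 (by rw [h])
      have hzy : y ≠ z := fun h => hne.2 (by rw [h])
      exact hyx (hinj _ hDF (by simp [hzy, hyS]) (by simp [hzx, hxS]) hcy)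
    · rintro (rfl | rfl)
      · exact hD
      · exact hmem
  rw [hFeq, Finset.card_pair]
  · exact even_two
  · intro h
    have : y ∈ S.erase x := Finset.mem_erase.2 ⟨hyx, hyS⟩
    rw [h] at this
    simp at this

/-- A Scarf-type lemma: with boundary vertices `e i`, there is a dominant set whose
elements carry each colour exactly once. -/
theorem exists_colourful_dominant {V I L : Type*} [Fintype V] [Fintype I] [Nontrivial I]
    [LinearOrder L] {h : I → V → L} (hinj : ∀ i, Function.Injective (h i)) {e : I → V}
    (hlow : ∀ i v, h i (e i) ≤ h i v)
    (hhigh : ∀ i j v, j ≠ i → v ∉ Set.range e → h i v < h i (e j))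
    (c : V → I) (hc : ∀ i, c (e i) = i) :
    ∃ S : Finset V, S.card = Fintype.card I ∧ Set.InjOn c S ∧ Dominant h S := by
  classical
  by_contra! hcon
  have heinj : Function.Injective e := Function.LeftInverse.injective hc
  obtain ⟨i₀⟩ : Nonempty I := inferInstance
  have hI : 1 < Fintype.card I := Fintype.one_lt_card
  set rooms := Finset.univ.filter fun S : Finset V => Dominant h S ∧ S.card = Fintype.card I
    with hrooms
  set doors := Finset.univ.filter fun D : Finset V =>
    Dominant h D ∧ D.card + 1 = Fintype.card I ∧ D.image c = Finset.univ.erase i₀ with hdoors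
  have hcount := Finset.sum_card_bipartiteAbove_eq_sum_card_bipartiteBelow
    (s := doors) (t := rooms) (fun D S => D ⊆ S)
  have heven : Even (∑ S ∈ rooms, (doors.bipartiteBelow (fun D S => D ⊆ S) S).card) := by
    refine Finset.even_sum _ fun S hS => ?_
    simp only [hrooms, Finset.mem_filter, Finset.mem_univ, true_and] at hS
    have := even_card_doors c i₀ hS.2 (fun hci => hcon S hS.2 hci hS.1) (Dominant h)
      (fun D hD => hS.1.mono hD)
    simpa only [Finset.bipartiteBelow, hdoors, Finset.filter_filter] using this
  rw [← hcount] at heven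
  set D₀ := (Finset.univ.erase i₀).image e with hD₀
  have hD₀mem : D₀ ∈ doors := by
    simp only [hdoors, Finset.mem_filter, Finset.mem_univ, true_and]
    refine ⟨fun v => ?_, ?_, ?_⟩
    · by_cases hv : v ∈ Set.range e
      · obtain ⟨j, rfl⟩ := hv
        exact ⟨j, fun s _ => hlow j s⟩
      · refine ⟨i₀, fun s hs => ?_⟩
        obtain ⟨k, hk, rfl⟩ := Finset.mem_image.1 hs
        exact (hhigh i₀ k v (Finset.mem_erase.1 hk).1 hv).le
    · rw [Finset.card_image_of_injective _ heinj, Finset.card_erase_add_one (Finset.mem_univ _),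
        Finset.card_univ]
    · rw [hD₀, Finset.image_image]
      rw [show c ∘ e = id from funext hc, Finset.image_id]
  have hmin : ∀ D ∈ doors, ∃ m : I → V, (∀ i, m i ∈ D) ∧ ∀ i, ∀ s ∈ D, h i (m i) ≤ h i s := by
    intro D hD
    simp only [hdoors, Finset.mem_filter, Finset.mem_univ, true_and] at hD
    have hne : D.Nonempty := Finset.card_pos.1 (by omega)
    choose m hmD hm using fun i => Finset.exists_min_image D (h i) hne
    exact ⟨m, hmD, hm⟩
  have habove : ∀ D, (rooms.bipartiteAbove (fun D S => D ⊆ S) D) =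
      Finset.univ.filter fun S : Finset V =>
        (Dominant h S ∧ S.card = Fintype.card I) ∧ D ⊆ S := fun D => by
    simp only [Finset.bipartiteAbove, hrooms, Finset.filter_filter]
  have hone : (rooms.bipartiteAbove (fun D S => D ⊆ S) D₀).card = 1 := by
    obtain ⟨m, hmD, hm⟩ := hmin D₀ hD₀mem
    simp only [hdoors, Finset.mem_filter, Finset.mem_univ, true_and] at hD₀mem
    obtain ⟨a, b, hab, hmab, hiff⟩ := exists_pair_of_door hinj hD₀mem.1 hD₀mem.2.1 hmD hm
    have hme : ∀ k, k ≠ i₀ → m k = e k := fun k hk =>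
      hinj k (le_antisymm (hm k _ (Finset.mem_image_of_mem e (by simpa using hk))) (hlow k _))
    have key : ∀ a b, a ≠ b → m a = m b → a = i₀ →
        (∀ x, (x ∉ D₀ ∧ Dominant h (insert x D₀)) ↔ (IsPivot h m a x ∨ IsPivot h m b x)) →
        (rooms.bipartiteAbove (fun D S => D ⊆ S) D₀).card = 1 := by
      rintro a b hab hmab rfl hiff
      have hmb := hme b hab.symm
      obtain ⟨x, hx⟩ := exists_isPivot h m a ⟨e a, fun i hi => by
        rw [hme i hi]
        exact lt_of_le_of_ne (hlow i _) fun heq => hi (heinj (hinj i heq))⟩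
      rw [habove, card_rooms_eq hD₀mem.2.1 (P := {x}), Finset.card_singleton]
      intro y
      rw [hiff, Finset.mem_singleton]
      constructor
      · rintro (hy | hy)
        · exact hy.unique hinj hx
        · exfalso
          have hya := hy.1 a hab
          rw [hmab, hmb] at hya
          by_cases hyr : y ∈ Set.range e
          · obtain ⟨j, rfl⟩ := hyr
            by_cases hjb : j = b
            · subst hjb; exact lt_irrefl _ hya
            · have := hy.1 j hjb
              by_cases hja : j = a
              · subst hja; exact absurd (hlow j (m j)) (not_le.2 this)
              · rw [hme j hja] at this; exact lt_irrefl _ this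
          · exact lt_asymm hya (hhigh a b y hab.symm hyr)
      · rintro rfl
        exact Or.inl hx
    by_cases ha : a = i₀
    · exact key a b hab hmab ha hiff
    by_cases hb : b = i₀
    · exact key b a hab.symm hmab.symm hb fun x => (hiff x).trans or_comm
    · rw [hme a ha, hme b hb] at hmab
      exact absurd (heinj hmab) hab
  have htwo : ∀ D ∈ doors.erase D₀, Even (rooms.bipartiteAbove (fun D S => D ⊆ S) D).card := by
    intro D hDe
    obtain ⟨hne, hD⟩ := Finset.mem_erase.1 hDe
    obtain ⟨m, hmD, hm⟩ := hmin D hD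
    simp only [hdoors, Finset.mem_filter, Finset.mem_univ, true_and] at hD
    obtain ⟨a, b, hab, hmab, hiff⟩ := exists_pair_of_door hinj hD.1 hD.2.1 hmD hm
    obtain ⟨t, htD, ht⟩ : ∃ t ∈ D, t ∉ Set.range e := by
      by_contra! hall
      refine hne (Finset.eq_of_subset_of_card_le (fun s hs => ?_) ?_)
      · obtain ⟨k, rfl⟩ := hall s hs
        refine Finset.mem_image_of_mem e ?_
        rw [← hD.2.2, ← hc k]
        simpa only [hc k] using Finset.mem_image_of_mem c hs
      · rw [hD₀, Finset.card_image_of_injective _ heinj,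
          Finset.card_erase_of_mem (Finset.mem_univ _), Finset.card_univ]
        exact (Nat.sub_eq_of_eq_add hD.2.1.symm).le
    have hpiv : ∀ j, ∃ x, IsPivot h m j x := fun j => exists_isPivot h m j
      ⟨e j, fun i hij => (hm i t htD).trans_lt (hhigh i j t hij.symm ht)⟩
    obtain ⟨x, hx⟩ := hpiv a
    obtain ⟨y, hy⟩ := hpiv b
    have hxy : x ≠ y := by
      rintro rfl
      obtain ⟨i, hi⟩ := hD.1 x
      by_cases hia : i = a
      · exact absurd (hi _ (hmD i)) (not_le.2 (hy.1 i (hia ▸ hab)))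
      · exact absurd (hi _ (hmD i)) (not_le.2 (hx.1 i hia))
    rw [habove, card_rooms_eq hD.2.1 (P := {x, y}), Finset.card_pair hxy]
    · exact even_two
    intro z
    rw [hiff, Finset.mem_insert, Finset.mem_singleton]
    constructor
    · rintro (hz | hz)
      · exact Or.inl (hz.unique hinj hx)
      · exact Or.inr (hz.unique hinj hy)
    · rintro (rfl | rfl)
      · exact Or.inl hx
      · exact Or.inr hy
  rw [← Finset.add_sum_erase _ _ hD₀mem, hone] at heven
  have := Finset.even_sum _ htwo
  rw [Nat.even_add] at heven
  exact absurd (heven.2 this) (by decide)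

/-- For every colouring of the points of the grid of mesh `1 / m` in the simplex there is a set of
colours `C` and nearby grid points of all these colours, whose coordinates outside `C` are small. -/
lemma exists_colourful_grid_points {I : Type*} [Fintype I] [Nontrivial I] (m : ℕ)
    (c : (I → ℕ) → I) :
    ∃ (C : Finset I) (x : I → I → ℕ), C.Nonempty ∧
      (∀ i ∈ C, ∑ k, x i k = m ∧ c (x i) = i) ∧
      (∀ i ∈ C, ∀ j ∈ C, ∀ k, x i k ≤ x j k + Fintype.card I) ∧
      (∀ i ∈ C, ∀ k, k ∉ C → x i k ≤ Fintype.card I) := by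
  classical
  let T := {k : I → Fin (m + 1) // ∑ i, (k i : ℕ) = m}
  let key : I → T ⊕ I → ℕ := fun i =>
    Sum.elim (fun k => (k.1 i : ℕ) + 1) (fun j => if j = i then 0 else m + 2)
  let h : I → T ⊕ I → ℕ ×ₗ ℕ := fun i v => toLex (key i v, (Fintype.equivFin (T ⊕ I) v : ℕ))
  have hlt : ∀ i v w, key i v < key i w → h i v < h i w := fun i v w hvw =>
    Prod.Lex.toLex_lt_toLex.2 (Or.inl hvw)
  have hle : ∀ i v w, h i v ≤ h i w → key i v ≤ key i w := fun i v w hvw => by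
    by_contra! hcon
    exact absurd hvw (not_le.2 (hlt i w v hcon))
  have hinj : ∀ i, Function.Injective (h i) := fun i v w hvw => by
    have : ((Fintype.equivFin (T ⊕ I) v : ℕ)) = (Fintype.equivFin (T ⊕ I) w : ℕ) :=
      congrArg (fun z => (ofLex z).2) hvw
    exact (Fintype.equivFin (T ⊕ I)).injective (Fin.ext this)
  have hlow : ∀ i v, h i (Sum.inr i) ≤ h i v := by
    intro i v
    by_cases hv : v = Sum.inr i
    · rw [hv]
    refine (hlt i _ _ ?_).le
    rcases v with k | j
    · simp [key]
    · have : j ≠ i := fun hj => hv (by rw [hj])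
      simp [key, this]
  have hhigh : ∀ i j v, j ≠ i → v ∉ Set.range (Sum.inr : I → T ⊕ I) →
      h i v < h i (Sum.inr j) := by
    intro i j v hji hv
    rcases v with k | l
    · refine hlt i _ _ ?_
      have := (k.1 i).2
      simp only [key, Sum.elim_inl, Sum.elim_inr, if_neg hji]
      omega
    · exact absurd ⟨l, rfl⟩ hv
  obtain ⟨S, hScard, hSinj, hSdom⟩ := exists_colourful_dominant hinj hlow hhigh
    (Sum.elim (fun k : T => c fun i => (k.1 i : ℕ)) id) (fun i => rfl)
  set c' : T ⊕ I → I := Sum.elim (fun k : T => c fun i => (k.1 i : ℕ)) id with hc'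
  have hsurj : ∀ i, ∃ s ∈ S, c' s = i := by
    have : S.image c' = Finset.univ := by
      rw [← Finset.card_eq_iff_eq_univ, Finset.card_image_iff.2 hSinj, hScard]
    intro i
    simpa using (this ▸ Finset.mem_univ i : i ∈ S.image c')
  set C : Finset I := Finset.univ.filter fun i => Sum.inr i ∉ S with hC
  have hpt : ∀ i, ∃ t : I → ℕ, i ∈ C → ∃ k : T, Sum.inl k ∈ S ∧ (∀ l, (k.1 l : ℕ) = t l) ∧
      c t = i := by
    intro i
    obtain ⟨s, hs, hsi⟩ := hsurj i
    rcases s with k | j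
    · exact ⟨fun l => k.1 l, fun _ => ⟨k, hs, fun _ => rfl, hsi⟩⟩
    · refine ⟨0, fun hi => ?_⟩
      have hji : j = i := hsi
      subst hji
      simp [hC, hs] at hi
  choose x hx using hpt
  have hsum : ∀ i ∈ C, ∑ k, x i k = m := fun i hi => by
    obtain ⟨k, -, hk, -⟩ := hx i hi
    rw [← k.2]
    exact Finset.sum_congr rfl fun l _ => (hk l).symm
  have hdom : ∀ v : I → ℕ, ∑ i, v i = m → ∃ i ∈ C, ∀ j ∈ C, v i ≤ x j i := by
    intro v hv
    have hvm : ∀ i, v i < m + 1 := fun i =>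
      Nat.lt_succ_of_le (hv ▸ Finset.single_le_sum (fun _ _ => Nat.zero_le _) (Finset.mem_univ i))
    obtain ⟨i, hi⟩ := hSdom (Sum.inl ⟨fun i => ⟨v i, hvm i⟩, hv⟩)
    refine ⟨i, ?_, fun j hj => ?_⟩
    · simp only [hC, Finset.mem_filter, Finset.mem_univ, true_and]
      intro hiS
      have := hle i _ _ (hi _ hiS)
      simp [key] at this
    · obtain ⟨k, hkS, hk, -⟩ := hx j hj
      have := hle i _ _ (hi _ hkS)
      simp only [key, Sum.elim_inl, hk] at this
      omega
  have hCne : C.Nonempty := by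
    obtain ⟨i₀⟩ : Nonempty I := inferInstance
    obtain ⟨i, hi, -⟩ := hdom (Pi.single i₀ m) (by simp)
    exact ⟨i, hi⟩
  choose a haC ha using fun i => Finset.exists_min_image C (fun j => x j i) hCne
  have hbig : m < ∑ i ∈ C, (x (a i) i + 1) := by
    by_contra! hcon
    obtain ⟨i₁, hi₁⟩ := hCne
    obtain ⟨i, hi, hv⟩ := hdom (fun i => (if i ∈ C then x (a i) i + 1 else 0) +
      (Pi.single i₁ (m - ∑ i ∈ C, (x (a i) i + 1)) : I → ℕ) i) (by
        rw [Finset.sum_add_distrib, Finset.sum_ite_mem, Finset.univ_inter]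
        simp only [Finset.sum_pi_single', Finset.mem_univ, if_true]
        omega)
    have := hv (a i) (haC i)
    simp only [if_pos hi] at this
    omega
  rw [Finset.sum_add_distrib, Finset.sum_const, smul_eq_mul, mul_one] at hbig
  have hCcard : C.card ≤ Fintype.card I := Finset.card_le_univ C
  have hle_sum : ∀ j ∈ C, ∑ i ∈ C, x (a i) i ≤ ∑ i ∈ C, x j i := fun j hj =>
    Finset.sum_le_sum fun i _ => ha i j hj
  have hout : ∀ i ∈ C, ∀ k, k ∉ C → x i k ≤ Fintype.card I := by
    intro i hi k hk
    have h1 : ∑ l ∈ insert k C, x i l ≤ ∑ l, x i l :=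
      Finset.sum_le_sum_of_subset (Finset.subset_univ _)
    rw [Finset.sum_insert hk, hsum i hi] at h1
    have := hle_sum i hi
    omega
  refine ⟨C, x, hCne, fun i hi => ⟨hsum i hi, ?_⟩, fun i hi j hj k => ?_, hout⟩
  · obtain ⟨-, -, -, h⟩ := hx i hi
    exact h
  · by_cases hk : k ∈ C
    · have h1 : ∑ l ∈ C, x i l ≤ ∑ l, x i l :=
        Finset.sum_le_sum_of_subset (Finset.subset_univ _)
      have h2 : ∑ l ∈ C.erase k, x (a l) l ≤ ∑ l ∈ C.erase k, x i l :=
        Finset.sum_le_sum fun l _ => ha l i hi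
      rw [hsum i hi, ← Finset.add_sum_erase C _ hk] at h1
      rw [← Finset.add_sum_erase C _ hk] at hbig
      have := ha k j hj
      omega
    · have := hout i hi k hk
      omega

/-- An approximate fixed point of a continuous self-map of the simplex. -/
lemma exists_approx_fixedPoint_stdSimplex {I : Type*} [Fintype I] [Nontrivial I]
    {f : (I → ℝ) → I → ℝ} (hf : ContinuousOn f (stdSimplex ℝ I))
    (hmaps : Set.MapsTo f (stdSimplex ℝ I) (stdSimplex ℝ I)) {ε : ℝ} (hε : 0 < ε) :
    ∃ x ∈ stdSimplex ℝ I, ∀ i, x i - f x i ≤ ε := by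
  classical
  have huc := (isCompact_stdSimplex ℝ I).uniformContinuousOn_of_continuous hf
  obtain ⟨δ, hδ, huc⟩ := Metric.uniformContinuousOn_iff.1 huc (ε / 2) (half_pos hε)
  set n : ℝ := (Fintype.card I : ℝ)
  have hn0 : 0 ≤ n := Nat.cast_nonneg _
  obtain ⟨m, hm⟩ := exists_nat_gt (n / min δ (ε / 2))
  have hmin : 0 < min δ (ε / 2) := lt_min hδ (half_pos hε)
  have hm0 : (0 : ℝ) < m := (div_nonneg hn0 hmin.le).trans_lt hm
  have hnm : n / m < min δ (ε / 2) := by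
    rw [div_lt_iff₀ hmin] at hm
    rw [div_lt_iff₀ hm0]
    linarith
  let pt : (I → ℕ) → I → ℝ := fun k i => (k i : ℝ) / m
  have hpt : ∀ k : I → ℕ, ∑ i, k i = m → pt k ∈ stdSimplex ℝ I := fun k hk => by
    refine ⟨fun i => by positivity, ?_⟩
    simp only [pt]
    rw [← Finset.sum_div, ← Nat.cast_sum, hk, div_self hm0.ne']
  have hcol : ∀ k : I → ℕ, ∃ i, ∑ i, k i = m → pt k i ≤ f (pt k) i := by
    intro k
    by_cases hk : ∑ i, k i = m
    · by_contra! hcon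
      have := Finset.sum_lt_sum_of_nonempty (s := Finset.univ) Finset.univ_nonempty
        fun i _ => (hcon i).2
      rw [(hpt k hk).2, (hmaps (hpt k hk)).2] at this
      exact lt_irrefl _ this
    · exact ⟨Classical.arbitrary I, fun h => absurd h hk⟩
  choose c hc using hcol
  obtain ⟨C, x, ⟨i₀, hi₀⟩, hx, hclose, hout⟩ := exists_colourful_grid_points m c
  have hdist : ∀ i ∈ C, ∀ j ∈ C, ∀ k, pt (x i) k ≤ pt (x j) k + n / m := fun i hi j hj k => by
    simp only [pt]
    rw [← add_div]
    gcongr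
    simp only [n]
    exact_mod_cast hclose i hi j hj k
  refine ⟨pt (x i₀), hpt _ (hx i₀ hi₀).1, fun i => ?_⟩
  by_cases hi : i ∈ C
  · have h1 := hc (x i) (hx i hi).1
    rw [(hx i hi).2] at h1
    have hd : dist (pt (x i)) (pt (x i₀)) < δ := by
      refine (dist_pi_lt_iff hδ).2 fun k => ?_
      rw [Real.dist_eq, abs_lt]
      have h2 := hdist i hi i₀ hi₀ k
      have h3 := hdist i₀ hi₀ i hi k
      have h4 := hnm.trans_le (min_le_left _ _)
      constructor <;> linarith
    have h2 := (dist_le_pi_dist _ _ i).trans_lt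
      (huc _ (hpt _ (hx i hi).1) _ (hpt _ (hx i₀ hi₀).1) hd)
    rw [Real.dist_eq, abs_lt] at h2
    have h3 := hdist i₀ hi₀ i hi i
    have h4 := hnm.trans_le (min_le_right _ _)
    linarith [h2.1, h2.2]
  · have h1 : pt (x i₀) i ≤ n / m := by
      simp only [pt]
      gcongr
      simp only [n]
      exact_mod_cast hout i₀ hi₀ i hi
    have h2 := (hmaps (hpt _ (hx i₀ hi₀).1)).1 i
    have h4 := hnm.trans_le (min_le_right _ _)
    linarith

/-- **Brouwer's fixed point theorem** for the standard simplex. -/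
theorem exists_fixedPoint_stdSimplex {I : Type*} [Fintype I] [Nontrivial I]
    {f : (I → ℝ) → I → ℝ} (hf : ContinuousOn f (stdSimplex ℝ I))
    (hmaps : Set.MapsTo f (stdSimplex ℝ I) (stdSimplex ℝ I)) :
    ∃ x ∈ stdSimplex ℝ I, f x = x := by
  classical
  let φ : (I → ℝ) → ℝ := fun x => Finset.univ.sup' Finset.univ_nonempty fun i => x i - f x i
  have hφ : ContinuousOn φ (stdSimplex ℝ I) :=
    ContinuousOn.finset_sup'_apply _ fun i _ =>
      (continuous_apply i).continuousOn.sub (continuousOn_pi.1 hf i)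
  obtain ⟨x, hx, hmin⟩ := (isCompact_stdSimplex ℝ I).exists_isMinOn
    ⟨_, single_mem_stdSimplex ℝ (Classical.arbitrary I)⟩ hφ
  have hφx : φ x ≤ 0 := le_of_forall_pos_le_add fun ε hε => by
    obtain ⟨y, hy, hyε⟩ := exists_approx_fixedPoint_stdSimplex hf hmaps hε
    rw [zero_add]
    exact (hmin hy).trans (Finset.sup'_le _ _ fun i _ => hyε i)
  have hle : ∀ i, x i ≤ f x i := fun i => by
    have : x i - f x i ≤ φ x :=
      Finset.le_sup' (fun i => x i - f x i) (Finset.mem_univ i)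
    linarith
  refine ⟨x, hx, funext fun i => ?_⟩
  have hsum : ∑ i, x i = ∑ i, f x i := hx.2.trans (hmaps hx).2.symm
  exact ((Finset.sum_eq_sum_iff_of_le fun i _ => hle i).1 hsum i (Finset.mem_univ i)).symm

/-- **Brouwer's fixed point theorem** for a bounded continuous self-map of `ℝ^J`. -/
theorem exists_fixedPoint_of_bounded {J : Type*} [Fintype J] {F : (J → ℝ) → J → ℝ}
    (hF : Continuous F) {M : ℝ} (hM : ∀ x j, |F x j| ≤ M) : ∃ x, F x = x := by
  classical
  rcases isEmpty_or_nonempty J with hJ | hJ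
  · exact ⟨0, Subsingleton.elim _ _⟩
  obtain ⟨j₀⟩ := id hJ
  obtain ⟨K, hK0, hK⟩ : ∃ K : ℝ, 0 < K ∧ ∀ x j, |F x j| ≤ K :=
    ⟨M + 1, by linarith [(abs_nonneg _).trans (hM 0 j₀)], fun x j => (hM x j).trans (by linarith)⟩
  have : Nontrivial (Option J) := ⟨none, some j₀, by simp⟩
  set s : ℝ := 2 * K * (Fintype.card J : ℝ) with hs
  have hcard : (0 : ℝ) < Fintype.card J := Nat.cast_pos.2 Fintype.card_pos
  have hs0 : 0 < s := by positivity
  let ρ : (Option J → ℝ) → J → ℝ := fun x j => s * x (some j) - K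
  let ι : (J → ℝ) → Option J → ℝ := fun y o =>
    o.elim (1 - ∑ j, (y j + K) / s) fun j => (y j + K) / s
  have hρ : Continuous ρ := by fun_prop
  have hι : Continuous ι := by
    refine continuous_pi fun o => ?_
    cases o <;> simp only [ι, Option.elim] <;> fun_prop
  obtain ⟨x, -, hx⟩ := exists_fixedPoint_stdSimplex (f := fun x => ι (F (ρ x)))
    (hι.comp (hF.comp hρ)).continuousOn (fun x _ => by
      refine ⟨fun o => ?_, ?_⟩
      · cases o with
        | none =>
          have : ∑ j, (F (ρ x) j + K) / s ≤ ∑ _j : J, 2 * K / s :=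
            Finset.sum_le_sum fun j _ => by
              gcongr
              linarith [(abs_le.1 (hK (ρ x) j)).2]
          rw [Finset.sum_const, Finset.card_univ, nsmul_eq_mul,
            show (Fintype.card J : ℝ) * (2 * K / s) = 1 by rw [hs]; field_simp] at this
          simp only [ι, Option.elim]
          linarith
        | some j =>
          simp only [ι, Option.elim]
          exact div_nonneg (by linarith [(abs_le.1 (hK (ρ x) j)).1]) hs0.le
      · rw [Fintype.sum_option]
        simp [ι])
  refine ⟨ρ x, funext fun j => ?_⟩
  have hxj : (F (ρ x) j + K) / s = x (some j) := congrFun hx (some j)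
  simp only [ρ] at hxj ⊢
  rw [← hxj]
  field_simp
  ring

/-! ## Lotteries carried by a finite sample space -/

/-- The mass function of the random variable `X` under the weights `w`. -/
def lawOf {Ω : Type*} [Fintype Ω] (w X : Ω → ℝ) : ℝ → ℝ :=
  fun t => ∑ ω, if X ω = t then w ω else 0

section LawOf

variable {Ω : Type*} [Fintype Ω] {w X : Ω → ℝ}

lemma finsum_mul_lawOf (w X : Ω → ℝ) (g : ℝ → ℝ) :
    ∑ᶠ x, g x * lawOf w X x = ∑ ω, w ω * g (X ω) := by
  classical
  rw [finsum_eq_sum_of_support_subset (s := Finset.univ.image X)]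
  · simp only [lawOf, Finset.mul_sum]
    rw [Finset.sum_comm]
    refine Finset.sum_congr rfl fun ω _ => ?_
    rw [Finset.sum_eq_single (X ω)]
    · simp [mul_comm]
    · intro b _ hb
      simp [hb.symm]
    · intro h
      exact absurd (Finset.mem_image_of_mem X (Finset.mem_univ ω)) h
  · intro x hx
    by_contra hcon
    refine hx ?_
    have : ∀ ω, X ω ≠ x := fun ω h => hcon (by simp [← h])
    simp [lawOf, this]

lemma support_lawOf (hw : ∀ ω, 0 ≤ w ω) :
    Function.support (lawOf w X) = X '' {ω | 0 < w ω} := by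
  ext t
  have hnn : ∀ ω ∈ Finset.univ, 0 ≤ if X ω = t then w ω else 0 := fun ω _ => by
    split_ifs
    exacts [hw ω, le_rfl]
  rw [Function.mem_support, lawOf, Ne, Finset.sum_eq_zero_iff_of_nonneg hnn]
  push Not
  constructor
  · rintro ⟨ω, -, hω⟩
    by_cases h : X ω = t
    · rw [if_pos h] at hω
      exact ⟨ω, lt_of_le_of_ne (hw ω) hω.symm, h⟩
    · exact absurd (if_neg h) hω
  · rintro ⟨ω, hω, h⟩
    refine ⟨ω, Finset.mem_univ _, ?_⟩
    rw [if_pos h]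
    exact ne_of_gt hω

lemma sum_mul_mem_Icc (hw : ∀ ω, 0 ≤ w ω) (hw1 : ∑ ω, w ω = 1) {Y : Ω → ℝ} {l r : ℝ}
    (hY : ∀ ω, Y ω ∈ Set.Icc l r) : ∑ ω, w ω * Y ω ∈ Set.Icc l r := by
  simpa only [smul_eq_mul] using
    (convex_Icc l r).sum_mem (fun ω _ => hw ω) hw1 (fun ω _ => hY ω)

/-- `K_a` of a lottery lies in any symmetric interval containing its values. -/
lemma abs_Kstat_lawOf_le (hw : ∀ ω, 0 ≤ w ω) (hw1 : ∑ ω, w ω = 1) {M : ℝ}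
    (hX : ∀ ω, |X ω| ≤ M) (a : EReal) : |Kstat a (lawOf w X)| ≤ M := by
  have hfin : (X '' {ω | 0 < w ω}).Finite := Set.toFinite _
  have hne : (X '' {ω | 0 < w ω}).Nonempty := by
    obtain ⟨ω, -, hω⟩ := Finset.exists_lt_of_sum_lt (s := Finset.univ) (f := fun _ : Ω => (0 : ℝ))
      (g := w) (by rw [hw1]; simp)
    exact ⟨_, ω, hω, rfl⟩
  unfold Kstat
  split_ifs with h1 h2 h3
  · rw [support_lawOf hw]
    obtain ⟨ω, -, hω⟩ := hne.csSup_mem hfin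
    exact hω ▸ hX ω
  · rw [support_lawOf hw]
    obtain ⟨ω, -, hω⟩ := hne.csInf_mem hfin
    exact hω ▸ hX ω
  · rw [expOf, finsum_mul_lawOf w X fun x => x]
    exact abs_le.2 (sum_mul_mem_Icc hw hw1 fun ω => abs_le.1 (hX ω))
  · set r := a.toReal
    have hr : r ≠ 0 := fun h => (EReal.toReal_eq_zero_iff.1 h).elim h3 fun h => h.elim h1 h2
    rw [finsum_mul_lawOf w X fun x => Real.exp (r * x)]
    have hmem := sum_mul_mem_Icc (Y := fun ω => Real.exp (r * X ω)) hw hw1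
      (l := Real.exp (-(|r| * M))) (r := Real.exp (|r| * M)) fun ω => by
        have : |r * X ω| ≤ |r| * M := by
          rw [abs_mul]
          exact mul_le_mul_of_nonneg_left (hX ω) (abs_nonneg r)
        exact ⟨Real.exp_le_exp.2 (abs_le.1 this).1, Real.exp_le_exp.2 (abs_le.1 this).2⟩
    have hpos := (Real.exp_pos _).trans_le hmem.1
    have hlog : |Real.log (∑ ω, w ω * Real.exp (r * X ω))| ≤ |r| * M :=
      abs_le.2 ⟨(Real.le_log_iff_exp_le hpos).2 hmem.1, (Real.log_le_iff_le_exp hpos).2 hmem.2⟩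
    rw [abs_mul, abs_inv, inv_mul_le_iff₀ (abs_pos.2 hr)]
    exact hlog

lemma measurable_Kstat_lawOf (w X : Ω → ℝ) : Measurable fun a => Kstat a (lawOf w X) := by
  have hs : ∀ b : EReal, MeasurableSet {a : EReal | a = b} := measurableSet_singleton
  refine Measurable.ite (hs ⊤) measurable_const (Measurable.ite (hs ⊥) measurable_const
    (Measurable.ite (hs 0) measurable_const ?_))
  simp only [fun a : EReal => finsum_mul_lawOf w X fun x => Real.exp (a.toReal * x)]
  have := measurable_ereal_toReal
  fun_prop

/-- `K_a` is continuous in the weights as long as the support does not change. -/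
lemma continuous_Kstat_lawOf {Y : Type*} [TopologicalSpace Y] {w : Y → Ω → ℝ}
    (hcont : ∀ ω, Continuous fun y => w y ω) (hw : ∀ y ω, 0 ≤ w y ω) (hw1 : ∀ y, ∑ ω, w y ω = 1)
    {P : Set Ω} (hP : ∀ y ω, 0 < w y ω ↔ ω ∈ P) (X : Ω → ℝ) (a : EReal) :
    Continuous fun y => Kstat a (lawOf (w y) X) := by
  have hsupp : ∀ y, Function.support (lawOf (w y) X) = X '' P := fun y => by
    rw [support_lawOf (hw y)]
    congr 1
    ext ω
    exact hP y ω
  unfold Kstat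
  split_ifs
  · simp only [hsupp]; exact continuous_const
  · simp only [hsupp]; exact continuous_const
  · simp only [expOf, finsum_mul_lawOf _ X fun x => x]
    fun_prop
  · simp only [finsum_mul_lawOf _ X fun x => Real.exp (a.toReal * x)]
    refine continuous_const.mul (Continuous.log (by fun_prop) fun y => ?_)
    obtain ⟨ω, -, hω⟩ := Finset.exists_lt_of_sum_lt (s := Finset.univ) (f := fun _ : Ω => (0 : ℝ))
      (g := w y) (by rw [hw1]; simp)
    exact ne_of_gt (Finset.sum_pos' (fun ω _ => mul_nonneg (hw y ω) (Real.exp_pos _).le)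
      ⟨ω, Finset.mem_univ _, mul_pos hω (Real.exp_pos _)⟩)

lemma abs_PhiInt_lawOf_le (μ : Measure EReal) [IsProbabilityMeasure μ] (hw : ∀ ω, 0 ≤ w ω)
    (hw1 : ∑ ω, w ω = 1) {M : ℝ} (hX : ∀ ω, |X ω| ≤ M) : |PhiInt μ (lawOf w X)| ≤ M := by
  simpa [PhiInt] using norm_integral_le_of_norm_le_const (μ := μ) (C := M)
    (f := fun a => Kstat a (lawOf w X)) (Filter.Eventually.of_forall fun a => abs_Kstat_lawOf_le hw hw1 hX a)

lemma continuous_PhiInt_lawOf (μ : Measure EReal) [IsProbabilityMeasure μ]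
    {Y : Type*} [TopologicalSpace Y] [FirstCountableTopology Y] {w : Y → Ω → ℝ}
    (hcont : ∀ ω, Continuous fun y => w y ω) (hw : ∀ y ω, 0 ≤ w y ω) (hw1 : ∀ y, ∑ ω, w y ω = 1)
    {P : Set Ω} (hP : ∀ y ω, 0 < w y ω ↔ ω ∈ P) {M : ℝ} (hX : ∀ ω, |X ω| ≤ M) :
    Continuous fun y => PhiInt μ (lawOf (w y) X) :=
  MeasureTheory.continuous_of_dominated (bound := fun _ => M)
    (fun y => (measurable_Kstat_lawOf (w y) X).aestronglyMeasurable)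
    (fun y => Filter.Eventually.of_forall fun a => abs_Kstat_lawOf_le (hw y) (hw1 y) hX a)
    (integrable_const M)
    (Filter.Eventually.of_forall fun a => continuous_Kstat_lawOf hcont hw hw1 hP X a)

end LawOf

/-! ## Logit responses -/

/-- The logit choice probabilities at scores `v`. -/
def logit {N : ℕ} (G : Game N) (lam : ℝ) (v : (Σ i, G.A i) → ℝ) : Profile G := fun i ai =>
  Real.exp (lam * v ⟨i, ai⟩) / ∑ bi, Real.exp (lam * v ⟨i, bi⟩)

section Logit

variable {N : ℕ} (G : Game N) (lam : ℝ)

lemma sum_exp_pos (v : (Σ i, G.A i) → ℝ) (i : Fin N) :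
    0 < ∑ bi, Real.exp (lam * v ⟨i, bi⟩) :=
  Finset.sum_pos (fun _ _ => Real.exp_pos _) Finset.univ_nonempty

lemma logit_pos (v : (Σ i, G.A i) → ℝ) (i : Fin N) (ai : G.A i) : 0 < logit G lam v i ai :=
  div_pos (Real.exp_pos _) (sum_exp_pos G lam v i)

lemma sum_logit (v : (Σ i, G.A i) → ℝ) (i : Fin N) : ∑ ai, logit G lam v i ai = 1 := by
  simp only [logit]
  rw [← Finset.sum_div, div_self (sum_exp_pos G lam v i).ne']

lemma continuous_logit (i : Fin N) (ai : G.A i) : Continuous fun v => logit G lam v i ai :=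
  Continuous.div (by fun_prop) (by fun_prop) fun v => (sum_exp_pos G lam v i).ne'

end Logit

section Weight

variable {N : ℕ} {G : Game N}

lemma sum_weight {p : Profile G} (hp : ∀ i, ∑ ai, p i ai = 1) : ∑ a, weight G p a = 1 := by
  classical
  simp only [weight]
  rw [← Fintype.prod_sum fun j b => p j b]
  simp [hp]

lemma sum_update_delta {p : Profile G} (hp : ∀ i, ∑ ai, p i ai = 1) (i : Fin N) (ai : G.A i)
    (j : Fin N) : ∑ b, Function.update p i (delta ai) j b = 1 := by
  by_cases hj : j = i
  · subst hj
    rw [Function.update_self, Finset.sum_eq_single ai] <;> simp +contextual [delta]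
  · simp [Function.update_of_ne hj, hp]

lemma weight_update_delta_nonneg {p : Profile G} (hp : ∀ i ai, 0 < p i ai) (i : Fin N)
    (ai : G.A i) (a : (j : Fin N) → G.A j) :
    0 ≤ weight G (Function.update p i (delta ai)) a := by
  refine Finset.prod_nonneg fun j _ => ?_
  by_cases hj : j = i
  · subst hj
    simp only [Function.update_self, delta]
    split_ifs <;> norm_num
  · simpa [Function.update_of_ne hj] using (hp j (a j)).le

lemma weight_update_delta_pos_iff {p : Profile G} (hp : ∀ i ai, 0 < p i ai) (i : Fin N)
    (ai : G.A i) (a : (j : Fin N) → G.A j) :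
    0 < weight G (Function.update p i (delta ai)) a ↔ a i = ai := by
  constructor
  · intro h
    by_contra hne
    refine h.ne' (Finset.prod_eq_zero (Finset.mem_univ i) ?_)
    simp [delta, hne]
  · intro h
    refine Finset.prod_pos fun j _ => ?_
    by_cases hj : j = i
    · subst hj
      simp [delta, h]
    · simpa [Function.update_of_ne hj] using hp j (a j)

lemma continuous_weight_update_delta {Y : Type*} [TopologicalSpace Y] {p : Y → Profile G}
    (hp : ∀ i ai, Continuous fun y => p y i ai) (i : Fin N) (ai : G.A i)
    (a : (j : Fin N) → G.A j) :
    Continuous fun y => weight G (Function.update (p y) i (delta ai)) a := by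
  refine continuous_finsetProd _ fun j _ => ?_
  by_cases hj : j = i
  · subst hj
    simp only [Function.update_self]
    exact continuous_const
  · simpa only [Function.update_of_ne hj] using hp j (a j)

end Weight

/-- existence of `LQRE_{λΦ}` equilibria for `Φ = ∫ K_a dμ(a)`. -/
theorem stmt2 {N : ℕ} (hN : 2 ≤ N) (μ : Measure EReal) [IsProbabilityMeasure μ]
    (G : Game N) (lam : ℝ) (hlam : 0 ≤ lam) :
    ∃ p : Profile G, IsMixed G p ∧ IsLQREPhi (PhiInt μ) lam G p := by
  classical
  obtain ⟨M, hM⟩ : ∃ M, ∀ i a, |G.u a i| ≤ M := by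
    obtain ⟨M, hM⟩ := (Set.finite_range fun z : Fin N × ((i : Fin N) → G.A i) =>
      |G.u z.2 z.1|).bddAbove
    exact ⟨M, fun i a => hM ⟨(i, a), rfl⟩⟩
  have hlaw : ∀ p : Profile G, ∀ i ai, payMass G p i ai =
      lawOf (weight G (Function.update p i (delta ai))) fun a => G.u a i := fun _ _ _ => by
    funext t
    exact Finset.sum_congr rfl fun _ _ => by congr
  have hnn := fun v : (Σ i, G.A i) → ℝ => weight_update_delta_nonneg (logit_pos G lam v)
  have hsum := fun (v : (Σ i, G.A i) → ℝ) i (ai : G.A i) =>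
    sum_weight (sum_update_delta (sum_logit G lam v) i ai)
  obtain ⟨v, hv⟩ := exists_fixedPoint_of_bounded
    (F := fun v (z : Σ i, G.A i) => PhiInt μ (payMass G (logit G lam v) z.1 z.2)) (M := M)
    (continuous_pi fun z => by
      simp only [hlaw]
      exact continuous_PhiInt_lawOf μ (P := {a | a z.1 = z.2})
        (continuous_weight_update_delta (continuous_logit G lam) z.1 z.2)
        (fun v => hnn v z.1 z.2) (fun v => hsum v z.1 z.2)
        (fun v => weight_update_delta_pos_iff (logit_pos G lam v) z.1 z.2) (hM z.1))
    (fun v z => by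
      rw [hlaw]
      exact abs_PhiInt_lawOf_le μ (hnn v z.1 z.2) (hsum v z.1 z.2) (hM z.1))
  refine ⟨logit G lam v, fun i => ⟨fun ai => (logit_pos G lam v i ai).le, sum_logit G lam v i⟩,
    fun i ai => ?_⟩
  have hvi : ∀ bi : G.A i, PhiInt μ (payMass G (logit G lam v) i bi) = v ⟨i, bi⟩ :=
    fun bi => congrFun hv ⟨i, bi⟩
  simp only [hvi]
  rfl

end Paper
end
end

section
/- Let μ be a Borel probability measure on the extended real line ℝ̄ = ℝ∪{−∞,+∞} with ε := μ({−∞})+μ({+∞}) > 0, and define Φ[X] = ∫_{ℝ̄} K_a[X] dμ(a) for every finitely supported real-valued lottery X. Consider the two-player game with action sets A_1={a_1,b_1}, A_2={a_2,b_2} and payoffs u_1(a_1,a_2)=1+1/ε, u_1(a_1,b_2)=0, u_1(b_1,a_2)=−1/ε, u_1(b_1,b_2)=1, u_2(a_1,a_2)=0, u_2(a_1,b_2)=1, u_2(b_1,a_2)=1, u_2(b_1,b_2)=0. This game has no Nash_Φ equilibrium, i.e., no mixed strategy profile p such that for each player i the support of p_i is contained in argmax_{a_i∈A_i} Φ[u_i(a_i,p_{-i})].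 -/
open Filter Topology MeasureTheory

noncomputable section

namespace Paper

/-- Player 1's payoffs in the variant of matching pennies of Table 4
(`true` = `a_i`, `false` = `b_i`). -/
def u1Game4 (e : ℝ) : Bool → Bool → ℝ := fun a b =>
  if a then (if b then 1 + 1 / e else 0) else (if b then -(1 / e) else 1)

/-- Player 2's payoffs in the variant of matching pennies of Table 4. -/
def u2Game4 : Bool → Bool → ℝ := fun a b =>
  if a then (if b then 0 else 1) else (if b then 1 else 0)

/-- The mass function of `v` when its argument is drawn from `q`. -/
def pushMass {β : Type*} [Fintype β] (v : β → ℝ) (q : β → ℝ) : ℝ → ℝ :=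
  fun t => ∑ b, if v b = t then q b else 0

lemma support_pushMass {β : Type*} [Fintype β] (v : β → ℝ) {q : β → ℝ} (hq : ∀ b, 0 ≤ q b) :
    Function.support (pushMass v q) = v '' {b | 0 < q b} := by
  have hnn : ∀ t, ∀ b ∈ Finset.univ, 0 ≤ (if v b = t then q b else 0) := by
    intro t b _
    split_ifs
    · exact hq b
    · exact le_rfl
  ext t
  simp only [Function.mem_support, pushMass, ne_eq, Finset.sum_eq_zero_iff_of_nonneg (hnn t)]
  constructor
  · intro h
    push Not at h
    obtain ⟨b, -, hb⟩ := h
    have hv : v b = t := by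
      by_contra hv
      simp [hv] at hb
    exact ⟨b, lt_of_le_of_ne (hq b) (by simpa [hv, eq_comm] using hb), hv⟩
  · rintro ⟨b, hb, rfl⟩ h
    have := h b (Finset.mem_univ b)
    simp only [if_true] at this
    exact hb.ne' this

lemma finsum_mul_pushMass {β : Type*} [Fintype β] (v : β → ℝ) (q : β → ℝ) (g : ℝ → ℝ) :
    ∑ᶠ x, g x * pushMass v q x = ∑ b, g (v b) * q b := by
  classical
  rw [finsum_eq_sum_of_support_subset (s := Finset.univ.image v)]
  · simp only [pushMass, Finset.mul_sum]
    rw [Finset.sum_comm]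
    refine Finset.sum_congr rfl fun b _ => ?_
    rw [Finset.sum_eq_single (v b)]
    · simp
    · intro x _ hx
      simp [hx.symm]
    · simp
  · intro x hx
    by_contra hne
    refine hx ?_
    have : ∀ b, v b ≠ x := by simpa using hne
    simp [pushMass, this]

lemma sum_mul_mem_Icc_s4 {β : Type*} [Fintype β] {q g : β → ℝ} (hq : IsDist q) {m M : ℝ}
    (h : ∀ b, 0 < q b → m ≤ g b ∧ g b ≤ M) :
    m ≤ ∑ b, g b * q b ∧ ∑ b, g b * q b ≤ M := by
  have aux : ∀ b, m * q b ≤ g b * q b ∧ g b * q b ≤ M * q b := by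
    intro b
    rcases (hq.1 b).eq_or_lt with h0 | h0
    · simp [← h0]
    · exact ⟨mul_le_mul_of_nonneg_right (h b h0).1 h0.le,
        mul_le_mul_of_nonneg_right (h b h0).2 h0.le⟩
  have hm := Finset.sum_le_sum fun b (_ : b ∈ Finset.univ) => (aux b).1
  have hM := Finset.sum_le_sum fun b (_ : b ∈ Finset.univ) => (aux b).2
  rw [← Finset.mul_sum, hq.2, mul_one] at hm hM
  exact ⟨hm, hM⟩

lemma IsDist.exists_pos {β : Type*} [Fintype β] {q : β → ℝ} (hq : IsDist q) : ∃ b, 0 < q b := by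
  by_contra! h
  have := Finset.sum_nonpos fun b (_ : b ∈ Finset.univ) => h b
  linarith [hq.2]

lemma Kstat_pushMass_mem_Icc {β : Type*} [Fintype β] {v q : β → ℝ} (hq : IsDist q) {m M : ℝ}
    (h : ∀ b, 0 < q b → m ≤ v b ∧ v b ≤ M) (a : EReal) :
    m ≤ Kstat a (pushMass v q) ∧ Kstat a (pushMass v q) ≤ M := by
  obtain ⟨b₀, hb₀⟩ := hq.exists_pos
  have hmem : v b₀ ∈ v '' {b | 0 < q b} := ⟨b₀, hb₀, rfl⟩
  have hup : ∀ x ∈ v '' {b | 0 < q b}, x ≤ M := by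
    rintro x ⟨b, hb, rfl⟩
    exact (h b hb).2
  have hlo : ∀ x ∈ v '' {b | 0 < q b}, m ≤ x := by
    rintro x ⟨b, hb, rfl⟩
    exact (h b hb).1
  unfold Kstat
  rw [support_pushMass v hq.1]
  split_ifs with h1 h2 h3
  · exact ⟨(hlo _ hmem).trans (le_csSup ⟨M, hup⟩ hmem), csSup_le ⟨_, hmem⟩ hup⟩
  · exact ⟨le_csInf ⟨_, hmem⟩ hlo, (csInf_le ⟨m, hlo⟩ hmem).trans (hup _ hmem)⟩
  · rw [expOf, finsum_mul_pushMass v q fun x => x]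
    exact sum_mul_mem_Icc_s4 hq h
  · have ht : a.toReal ≠ 0 := by
      intro h0
      rcases EReal.toReal_eq_zero_iff.1 h0 with h | h | h <;> contradiction
    generalize a.toReal = t at ht
    rw [finsum_mul_pushMass v q fun x => Real.exp (t * x)]
    rcases ht.lt_or_gt with ht | ht
    · obtain ⟨hl, hu⟩ := sum_mul_mem_Icc_s4 (g := fun b => Real.exp (t * v b)) (m := Real.exp (t * M))
        (M := Real.exp (t * m)) hq fun b hb =>
          ⟨Real.exp_le_exp.2 (mul_le_mul_of_nonpos_left (h b hb).2 ht.le),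
            Real.exp_le_exp.2 (mul_le_mul_of_nonpos_left (h b hb).1 ht.le)⟩
      have hpos := (Real.exp_pos _).trans_le hl
      rw [← Real.le_log_iff_exp_le hpos] at hl
      rw [← Real.log_le_iff_le_exp hpos] at hu
      rw [inv_mul_eq_div, le_div_iff_of_neg ht, div_le_iff_of_neg ht]
      constructor <;> linarith
    · obtain ⟨hl, hu⟩ := sum_mul_mem_Icc_s4 (g := fun b => Real.exp (t * v b)) (m := Real.exp (t * m))
        (M := Real.exp (t * M)) hq fun b hb =>
          ⟨Real.exp_le_exp.2 (mul_le_mul_of_nonneg_left (h b hb).1 ht.le),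
            Real.exp_le_exp.2 (mul_le_mul_of_nonneg_left (h b hb).2 ht.le)⟩
      have hpos := (Real.exp_pos _).trans_le hl
      rw [← Real.le_log_iff_exp_le hpos] at hl
      rw [← Real.log_le_iff_le_exp hpos] at hu
      rw [inv_mul_eq_div, le_div_iff₀ ht, div_le_iff₀ ht]
      constructor <;> linarith

lemma measurable_Kstat_pushMass {β : Type*} [Fintype β] (v q : β → ℝ) :
    Measurable fun a => Kstat a (pushMass v q) := by
  unfold Kstat
  refine Measurable.ite (measurableSet_singleton _) measurable_const
    (Measurable.ite (measurableSet_singleton _) measurable_const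
      (Measurable.ite (measurableSet_singleton _) measurable_const ?_))
  have hsum : ∀ a : EReal, ∑ᶠ x, Real.exp (a.toReal * x) * pushMass v q x =
      ∑ b, Real.exp (a.toReal * v b) * q b :=
    fun a => finsum_mul_pushMass v q fun x => Real.exp (a.toReal * x)
  simp only [hsum]
  have := measurable_ereal_toReal
  fun_prop

lemma integrable_Kstat_pushMass {β : Type*} [Fintype β] (μ : Measure EReal)
    [IsProbabilityMeasure μ] (v : β → ℝ) {q : β → ℝ} (hq : IsDist q) :
    Integrable (fun a => Kstat a (pushMass v q)) μ := by
  refine Integrable.of_bound (measurable_Kstat_pushMass v q).aestronglyMeasurable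
    (∑ b, |v b|) (ae_of_all _ fun a => ?_)
  rw [Real.norm_eq_abs, abs_le]
  refine Kstat_pushMass_mem_Icc hq (fun b _ => abs_le.1 ?_) a
  exact Finset.single_le_sum (f := fun b => |v b|) (fun _ _ => abs_nonneg _) (Finset.mem_univ b)

lemma PhiInt_pushMass_of_const {β : Type*} [Fintype β] (μ : Measure EReal)
    [IsProbabilityMeasure μ] {v q : β → ℝ} (hq : IsDist q) {c : ℝ}
    (h : ∀ b, 0 < q b → v b = c) : PhiInt μ (pushMass v q) = c := by
  have hK : ∀ a, Kstat a (pushMass v q) = c := fun a => by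
    obtain ⟨h1, h2⟩ := Kstat_pushMass_mem_Icc hq (fun b hb => ⟨(h b hb).ge, (h b hb).le⟩) a
    exact le_antisymm h2 h1
  simp [PhiInt, hK]

lemma support_pushMass_bool (v : Bool → ℝ) {q : Bool → ℝ} (ht : 0 < q true) (hf : 0 < q false) :
    Function.support (pushMass v q) = {v false, v true} := by
  have huniv : {b | 0 < q b} = Set.univ := by
    ext b
    cases b <;> simp [ht, hf]
  rw [support_pushMass v (by rintro (_ | _) <;> linarith), huniv, Set.image_univ]
  ext x
  simp

lemma Kstat_top_pushMass_bool (v : Bool → ℝ) {q : Bool → ℝ} (ht : 0 < q true)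
    (hf : 0 < q false) : Kstat ⊤ (pushMass v q) = max (v false) (v true) := by
  simp [Kstat, support_pushMass_bool v ht hf]

lemma Kstat_bot_pushMass_bool (v : Bool → ℝ) {q : Bool → ℝ} (ht : 0 < q true)
    (hf : 0 < q false) : Kstat ⊥ (pushMass v q) = min (v false) (v true) := by
  simp [Kstat, support_pushMass_bool v ht hf]

lemma PhiInt_u1Game4_lt (μ : Measure EReal) [IsProbabilityMeasure μ] {e : ℝ}
    (hμ : e = (μ {⊥}).toReal + (μ {⊤}).toReal) (he : 0 < e)
    {q : Bool → ℝ} (hq : IsDist q) (ht : 0 < q true) (hf : 0 < q false) :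
    PhiInt μ (pushMass (u1Game4 e false) q) < PhiInt μ (pushMass (u1Game4 e true) q) := by
  have hinv : 0 < 1 / e := by positivity
  have hE : MeasurableSet ({⊥, ⊤} : Set EReal) := (Set.toFinite _).measurableSet
  have hreal : μ.real {⊥, ⊤} = e := by
    rw [hμ, ← Set.singleton_union, measureReal_union (by simp) (measurableSet_singleton _)]
    rfl
  have hlow : ∀ a, Kstat a (pushMass (u1Game4 e false) q) +
      (({⊥, ⊤} : Set EReal).indicator (fun _ => 1 / e + 1) a - 1) ≤
        Kstat a (pushMass (u1Game4 e true) q) := by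
    intro a
    by_cases ha : a ∈ ({⊥, ⊤} : Set EReal)
    · rw [Set.indicator_of_mem ha]
      rcases ha with rfl | rfl
      · rw [Kstat_bot_pushMass_bool _ ht hf, Kstat_bot_pushMass_bool _ ht hf]
        simp only [u1Game4, if_true, Bool.false_eq_true, if_false]
        rw [min_eq_right (by linarith), min_eq_left (by linarith)]
        linarith
      · rw [Kstat_top_pushMass_bool _ ht hf, Kstat_top_pushMass_bool _ ht hf]
        simp only [u1Game4, if_true, Bool.false_eq_true, if_false]
        rw [max_eq_left (by linarith), max_eq_right (by linarith)]
        linarith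
    · rw [Set.indicator_of_notMem ha]
      have h1 := (Kstat_pushMass_mem_Icc (v := u1Game4 e false) hq (m := -(1 / e)) (M := 1)
        (by rintro (_ | _) _ <;> simp only [u1Game4, if_true, Bool.false_eq_true, if_false] <;>
          constructor <;> linarith) a).2
      have h2 := (Kstat_pushMass_mem_Icc (v := u1Game4 e true) hq (m := 0) (M := 1 + 1 / e)
        (by rintro (_ | _) _ <;> simp only [u1Game4, if_true, Bool.false_eq_true, if_false] <;>
          constructor <;> linarith) a).1
      linarith
  have hind : Integrable (({⊥, ⊤} : Set EReal).indicator fun _ => 1 / e + 1) μ :=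
    (integrable_const _).indicator hE
  have hint := integral_mono
    ((integrable_Kstat_pushMass μ (u1Game4 e false) hq).add (hind.sub (integrable_const 1)))
    (integrable_Kstat_pushMass μ (u1Game4 e true) hq) hlow
  rw [integral_add' (integrable_Kstat_pushMass μ _ hq) (hind.sub (integrable_const 1)),
    integral_sub' hind (integrable_const 1), integral_indicator_const _ hE, hreal] at hint
  have hmul : e * (1 / e + 1) = 1 + e := by field_simp
  simp only [smul_eq_mul, hmul, integral_const, probReal_univ, mul_one] at hint
  unfold PhiInt
  linarith

lemma IsDist.add_bool {q : Bool → ℝ} (hq : IsDist q) : q true + q false = 1 := by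
  simpa using hq.2

lemma IsDist.PhiInt_pushMass_bool (μ : Measure EReal) [IsProbabilityMeasure μ] (v : Bool → ℝ)
    {q : Bool → ℝ} (hq : IsDist q) {b : Bool} (hb : q (!b) = 0) :
    PhiInt μ (pushMass v q) = v b := by
  refine PhiInt_pushMass_of_const μ hq fun c hc => ?_
  rcases Bool.eq_or_eq_not c b with rfl | rfl
  · rfl
  · exact absurd hb hc.ne'

/-- if `ε = μ({−∞}) + μ({+∞}) > 0`, the given variant of matching pennies
has no `Nash_Φ` equilibrium, where `Φ = ∫ K_a dμ(a)`. -/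
theorem stmt4 (μ : Measure EReal) [IsProbabilityMeasure μ]
    (he : 0 < (μ {⊥}).toReal + (μ {⊤}).toReal) :
    ¬ ∃ p q : Bool → ℝ, IsDist p ∧ IsDist q ∧
      (∀ a : Bool, 0 < p a → ∀ a' : Bool,
        PhiInt μ (mass1 (u1Game4 ((μ {⊥}).toReal + (μ {⊤}).toReal)) q a') ≤
          PhiInt μ (mass1 (u1Game4 ((μ {⊥}).toReal + (μ {⊤}).toReal)) q a)) ∧
      (∀ b : Bool, 0 < q b → ∀ b' : Bool,
        PhiInt μ (mass2 u2Game4 p b') ≤ PhiInt μ (mass2 u2Game4 p b)) := by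
  rintro ⟨p, q, hp, hq, h1, h2⟩
  generalize hμ : (μ {⊥}).toReal + (μ {⊤}).toReal = e at he h1
  have hinv : 0 < 1 / e := by positivity
  change ∀ a, 0 < p a → ∀ a', PhiInt μ (pushMass (u1Game4 e a') q) ≤
    PhiInt μ (pushMass (u1Game4 e a) q) at h1
  change ∀ b, 0 < q b → ∀ b', PhiInt μ (pushMass (fun a => u2Game4 a b') p) ≤
    PhiInt μ (pushMass (fun a => u2Game4 a b) p) at h2
  rcases (hq.1 true).eq_or_lt with hqt | hqt
  · have hpt : p true = 0 := by
      by_contra hne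
      have h := h1 true (lt_of_le_of_ne (hp.1 true) (Ne.symm hne)) false
      rw [hq.PhiInt_pushMass_bool μ _ (b := false) hqt.symm,
        hq.PhiInt_pushMass_bool μ _ (b := false) hqt.symm] at h
      norm_num [u1Game4] at h
    have h := h2 false (by linarith [hq.add_bool]) true
    rw [hp.PhiInt_pushMass_bool μ _ (b := false) hpt,
      hp.PhiInt_pushMass_bool μ _ (b := false) hpt] at h
    norm_num [u2Game4] at h
  · have hpf : p false = 0 := by
      by_contra hne
      have h := h1 false (lt_of_le_of_ne (hp.1 false) (Ne.symm hne)) true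
      rcases (hq.1 false).eq_or_lt with hqf | hqf
      · rw [hq.PhiInt_pushMass_bool μ _ (b := true) hqf.symm,
          hq.PhiInt_pushMass_bool μ _ (b := true) hqf.symm] at h
        simp only [u1Game4, if_true, Bool.false_eq_true, if_false] at h
        linarith
      · exact absurd h (PhiInt_u1Game4_lt μ hμ.symm he hq hqt hqf).not_ge
    have h := h2 true hqt false
    rw [hp.PhiInt_pushMass_bool μ _ (b := true) hpf,
      hp.PhiInt_pushMass_bool μ _ (b := true) hpf] at h
    norm_num [u2Game4] at h

end Paper
end
end
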